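/- Let b ≥ 2 be an integer and let μ be a non-atomic self-similar measure on ℝ associated to a self-similar IFS {f_i(x) = s_i·x + t_i}_{i=1}^n and a strictly positive probability vector (p_1,…,p_n). If there is some i such that log|s_i| / log b is irrational, then μ-almost every x ∈ ℝ is normal in base b, i.e. for every continuous function g : [0,1] → ℝ one has (1/N)·Σ_{k=0}^{N-1} g(b^k·x mod 1) → ∫_0^1 g dλ as N → ∞, where λ is Lebesgue measure. -/

import Mathlib

open MeasureTheory Filter Topology
/-- Weyl's criterion on the circle, for continuous test functions on the circle. -/
theorem weyl_addCircle (y : ℕ → ℝ)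
    (hy : ∀ j : ℤ, j ≠ 0 → Tendsto (fun N : ℕ => (N : ℂ)⁻¹ *
      ∑ k ∈ Finset.range N, Complex.exp (2 * Real.pi * Complex.I * j * y k)) atTop (𝓝 0))
    (F : C(UnitAddCircle, ℂ)) :
    Tendsto (fun N : ℕ => (N : ℂ)⁻¹ * ∑ k ∈ Finset.range N, F (y k : UnitAddCircle))
      atTop (𝓝 (∫ u in (0 : ℝ)..1, F (u : UnitAddCircle))) := by
  have hint : ∀ G : C(UnitAddCircle, ℂ),
      IntervalIntegrable (fun u : ℝ => G (u : UnitAddCircle)) volume 0 1 := fun G =>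
    (G.continuous.comp (AddCircle.continuous_mk' 1)).intervalIntegrable _ _
  set A : ℕ → C(UnitAddCircle, ℂ) → ℂ := fun N G =>
    (N : ℂ)⁻¹ * ∑ k ∈ Finset.range N, G (y k : UnitAddCircle)
      - ∫ u in (0 : ℝ)..1, G (u : UnitAddCircle) with hA
  have hAsub : ∀ N G H, A N (G - H) = A N G - A N H := by
    intro N G H
    simp only [hA, ContinuousMap.sub_apply, Finset.sum_sub_distrib]
    rw [intervalIntegral.integral_sub (hint G) (hint H)]
    ring
  have hAnorm : ∀ N G, ‖A N G‖ ≤ 2 * ‖G‖ := by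
    intro N G
    have h1 : ‖∑ k ∈ Finset.range N, G (y k : UnitAddCircle)‖ ≤ N * ‖G‖ := by
      refine (norm_sum_le_of_le _ (fun k _ => G.norm_coe_le_norm _)).trans ?_
      simp
    have h2 : ‖∫ u in (0 : ℝ)..1, G (u : UnitAddCircle)‖ ≤ ‖G‖ := by
      have := intervalIntegral.norm_integral_le_of_norm_le_const (a := (0 : ℝ)) (b := 1)
        (f := fun u : ℝ => G (u : UnitAddCircle)) (C := ‖G‖) (fun u _ => G.norm_coe_le_norm _)
      simpa using this
    have h3 : ‖(N : ℂ)⁻¹ * ∑ k ∈ Finset.range N, G (y k : UnitAddCircle)‖ ≤ ‖G‖ := by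
      rw [norm_mul, norm_inv, Complex.norm_natCast]
      rcases Nat.eq_zero_or_pos N with rfl | hN
      · simp
      · rw [inv_mul_le_iff₀ (by positivity)]
        exact h1
    calc ‖A N G‖ ≤ _ := norm_sub_le _ _
      _ ≤ 2 * ‖G‖ := by linarith
  suffices h : Tendsto (fun N => A N F) atTop (𝓝 0) by
    have := h.add_const (∫ u in (0 : ℝ)..1, F (u : UnitAddCircle))
    simpa [hA] using this
  have hspan : ∀ G ∈ Submodule.span ℂ (Set.range (@fourier 1)),
      Tendsto (fun N => A N G) atTop (𝓝 0) := by
    intro G hG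
    induction hG using Submodule.span_induction with
    | mem G hG =>
      obtain ⟨j, rfl⟩ := hG
      by_cases hj : j = 0
      · subst hj
        apply tendsto_const_nhds.congr'
        filter_upwards [eventually_gt_atTop 0] with N hN
        have : (N : ℂ) ≠ 0 := by exact_mod_cast hN.ne'
        simp [hA, this]
      · have hz : ∫ u in (0 : ℝ)..1, (fourier j (u : UnitAddCircle) : ℂ) = 0 := by
          have hc : (2 * Real.pi * Complex.I * j : ℂ) ≠ 0 := by
            have : (j : ℂ) ≠ 0 := by exact_mod_cast hj
            simp [Real.pi_ne_zero, this]
          have : ∀ u : ℝ, (fourier j (u : UnitAddCircle) : ℂ)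
              = Complex.exp ((2 * Real.pi * Complex.I * j) * u) := by
            intro u; rw [fourier_coe_apply]; simp
          simp_rw [this]
          rw [integral_exp_mul_complex hc]
          have : Complex.exp (2 * Real.pi * Complex.I * j * (1 : ℝ)) = 1 := by
            rw [Complex.exp_eq_one_iff]
            exact ⟨j, by push_cast; ring⟩
          rw [this]; simp
        refine (hy j hj).congr fun N => ?_
        simp only [hA, hz, sub_zero]
        congr 1
        refine Finset.sum_congr rfl fun k _ => ?_
        rw [fourier_coe_apply]; simp
    | zero => simp [hA]
    | add G H _ _ hG hH =>
      have := hG.add hH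
      rw [add_zero] at this
      refine this.congr fun N => ?_
      simp only [hA, ContinuousMap.add_apply, Finset.sum_add_distrib]
      rw [intervalIntegral.integral_add (hint G) (hint H)]
      ring
    | smul c G _ hG =>
      have := hG.const_mul c
      rw [mul_zero] at this
      refine this.congr fun N => ?_
      simp only [hA, ContinuousMap.smul_apply, smul_eq_mul, ← Finset.mul_sum]
      rw [intervalIntegral.integral_const_mul]
      ring
  rw [Metric.tendsto_atTop]
  intro ε hε
  have hF : F ∈ closure (Submodule.span ℂ (Set.range (@fourier 1)) : Set C(UnitAddCircle, ℂ)) := by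
    have : F ∈ (Submodule.span ℂ (Set.range (@fourier 1))).topologicalClosure := by
      rw [span_fourier_closure_eq_top]; trivial
    exact this
  obtain ⟨G, hG, hd⟩ := Metric.mem_closure_iff.1 hF (ε / 4) (by positivity)
  obtain ⟨N₀, hN₀⟩ := Metric.tendsto_atTop.1 (hspan G hG) (ε / 2) (by positivity)
  refine ⟨N₀, fun N hN => ?_⟩
  have h1 := hN₀ N hN
  have h2 := hAnorm N (F - G)
  rw [hAsub] at h2
  rw [dist_eq_norm] at hd
  rw [dist_zero_right] at h1 ⊢
  calc ‖A N F‖ = ‖(A N F - A N G) + A N G‖ := by congr 1; ring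
    _ ≤ ‖A N F - A N G‖ + ‖A N G‖ := norm_add_le _ _
    _ < ε := by linarith

/-- Weyl's criterion for fractional parts and functions with equal values at `0` and `1`. -/
theorem weyl_of_eq_endpoints (y : ℕ → ℝ)
    (hy : ∀ j : ℤ, j ≠ 0 → Tendsto (fun N : ℕ => (N : ℂ)⁻¹ *
      ∑ k ∈ Finset.range N, Complex.exp (2 * Real.pi * Complex.I * j * y k)) atTop (𝓝 0))
    (g : ℝ → ℝ) (hg : Continuous g) (h01 : g 0 = g 1) :
    Tendsto (fun N : ℕ => (N : ℝ)⁻¹ * ∑ k ∈ Finset.range N, g (Int.fract (y k)))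
      atTop (𝓝 (∫ u in (0 : ℝ)..1, g u)) := by
  have hcont : Continuous (AddCircle.liftIco (1 : ℝ) 0 (fun u => (g u : ℂ))) := by
    apply AddCircle.liftIco_continuous
    · simp [h01]
    · exact (Complex.continuous_ofReal.comp hg).continuousOn
  have hval : ∀ v : ℝ, AddCircle.liftIco (1 : ℝ) 0 (fun u => (g u : ℂ)) (v : UnitAddCircle)
      = g (Int.fract v) := by
    intro v
    have : (v : UnitAddCircle) = (Int.fract v : ℝ) := by
      rw [← sub_eq_zero, ← AddCircle.coe_sub, AddCircle.coe_eq_zero_iff]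
      exact ⟨⌊v⌋, by rw [Int.self_sub_fract]; simp⟩
    rw [this, AddCircle.liftIco_coe_apply]
    exact ⟨Int.fract_nonneg v, by simpa using Int.fract_lt_one v⟩
  have := weyl_addCircle y hy ⟨_, hcont⟩
  simp only [ContinuousMap.coe_mk, hval] at this
  have hI : ∫ u in (0 : ℝ)..1, ((g (Int.fract u) : ℝ) : ℂ) = ((∫ u in (0 : ℝ)..1, g u : ℝ) : ℂ) := by
    rw [← intervalIntegral.integral_ofReal]
    apply intervalIntegral.integral_congr_ae
    have h1 : ∀ᵐ u : ℝ, u ≠ 1 := by simp [ae_iff]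
    filter_upwards [h1] with u hu1 hu
    rw [Set.uIoc_of_le zero_le_one] at hu
    rw [Int.fract_eq_self.2 ⟨hu.1.le, lt_of_le_of_ne hu.2 hu1⟩]
  rw [hI] at this
  have h2 := (Complex.continuous_re.tendsto _).comp this
  simp only [Complex.ofReal_re] at h2
  refine h2.congr fun N => ?_
  simp only [Function.comp]
  rw [← Complex.ofReal_re ((N : ℝ)⁻¹ * _)]
  push_cast
  rfl

/-- Weyl's criterion for fractional parts and continuous functions on `ℝ`. -/
theorem weyl_fract (y : ℕ → ℝ)
    (hy : ∀ j : ℤ, j ≠ 0 → Tendsto (fun N : ℕ => (N : ℂ)⁻¹ *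
      ∑ k ∈ Finset.range N, Complex.exp (2 * Real.pi * Complex.I * j * y k)) atTop (𝓝 0))
    (g : ℝ → ℝ) (hg : Continuous g) :
    Tendsto (fun N : ℕ => (N : ℝ)⁻¹ * ∑ k ∈ Finset.range N, g (Int.fract (y k)))
      atTop (𝓝 (∫ u in (0 : ℝ)..1, g u)) := by
  have hid : Tendsto (fun N : ℕ => (N : ℝ)⁻¹ * ∑ k ∈ Finset.range N, Int.fract (y k))
      atTop (𝓝 (1 / 2)) := by
    have hup : ∀ m : ℕ, 0 < m → Tendsto (fun N : ℕ => (N : ℝ)⁻¹ * ∑ k ∈ Finset.range N,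
        (Int.fract (y k) + (1 - Int.fract (y k)) ^ m)) atTop (𝓝 (1 / 2 + 1 / (m + 1))) := by
      intro m hm
      have := weyl_of_eq_endpoints y hy (fun u => u + (1 - u) ^ m) (by fun_prop)
        (by simp [hm.ne'])
      have hI : ∫ u in (0 : ℝ)..1, (u + (1 - u) ^ m) = 1 / 2 + 1 / (m + 1) := by
        rw [intervalIntegral.integral_add (by simp)
          (Continuous.intervalIntegrable (by fun_prop) _ _)]
        rw [intervalIntegral.integral_comp_sub_left (fun u => u ^ m)]
        simp
      rwa [hI] at this
    have hlo : ∀ m : ℕ, 0 < m → Tendsto (fun N : ℕ => (N : ℝ)⁻¹ * ∑ k ∈ Finset.range N,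
        (Int.fract (y k) - Int.fract (y k) ^ m)) atTop (𝓝 (1 / 2 - 1 / (m + 1))) := by
      intro m hm
      have := weyl_of_eq_endpoints y hy (fun u => u - u ^ m) (by fun_prop)
        (by simp [hm.ne'])
      have hI : ∫ u in (0 : ℝ)..1, (u - u ^ m) = 1 / 2 - 1 / (m + 1) := by
        rw [intervalIntegral.integral_sub (by simp)
          (Continuous.intervalIntegrable (by fun_prop) _ _)]
        simp
      rwa [hI] at this
    rw [Metric.tendsto_atTop]
    intro ε hε
    obtain ⟨m, hm⟩ := exists_nat_one_div_lt (half_pos hε)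
    have hm' : (1 : ℝ) / ((m + 1 : ℕ) + 1) < ε / 2 := by
      refine lt_of_le_of_lt ?_ hm
      apply one_div_le_one_div_of_le (by positivity)
      push_cast; linarith
    obtain ⟨N₁, h₁⟩ := Metric.tendsto_atTop.1 (hup (m + 1) (by omega)) (ε / 2) (by positivity)
    obtain ⟨N₂, h₂⟩ := Metric.tendsto_atTop.1 (hlo (m + 1) (by omega)) (ε / 2) (by positivity)
    refine ⟨max N₁ N₂, fun N hN => ?_⟩
    have h1 := h₁ N (le_trans (le_max_left _ _) hN)
    have h2 := h₂ N (le_trans (le_max_right _ _) hN)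
    rw [Real.dist_eq, abs_lt] at *
    have hu : (N : ℝ)⁻¹ * ∑ k ∈ Finset.range N, Int.fract (y k) ≤ (N : ℝ)⁻¹ *
        ∑ k ∈ Finset.range N, (Int.fract (y k) + (1 - Int.fract (y k)) ^ (m + 1)) := by
      gcongr with k _
      have : (0 : ℝ) ≤ 1 - Int.fract (y k) := by linarith [Int.fract_lt_one (y k)]
      have : (0 : ℝ) ≤ (1 - Int.fract (y k)) ^ (m + 1) := by positivity
      linarith
    have hl : (N : ℝ)⁻¹ * ∑ k ∈ Finset.range N, (Int.fract (y k) - Int.fract (y k) ^ (m + 1)) ≤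
        (N : ℝ)⁻¹ * ∑ k ∈ Finset.range N, Int.fract (y k) := by
      gcongr with k _
      have : (0 : ℝ) ≤ Int.fract (y k) ^ (m + 1) := by
        have := Int.fract_nonneg (y k); positivity
      linarith
    constructor <;> linarith [h1.1, h1.2, h2.1, h2.2]
  have hper := weyl_of_eq_endpoints y hy (fun u => g u - (g 1 - g 0) * u) (by fun_prop) (by simp)
  have hsum := hper.add (hid.const_mul (g 1 - g 0))
  have hI : (∫ u in (0 : ℝ)..1, (g u - (g 1 - g 0) * u)) + (g 1 - g 0) * (1 / 2)
      = ∫ u in (0 : ℝ)..1, g u := by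
    rw [intervalIntegral.integral_sub (hg.intervalIntegrable _ _)
      (Continuous.intervalIntegrable (by fun_prop) _ _), intervalIntegral.integral_const_mul]
    simp
  rw [hI] at hsum
  refine hsum.congr fun N => ?_
  rw [Finset.sum_sub_distrib, ← Finset.mul_sum]
  ring

/-- The sequence whose first `m` letters are those of `ω` and which continues with `ω'`. -/
def glue {n : ℕ} (m : ℕ) (ω ω' : ℕ → Fin n) : ℕ → Fin n :=
  fun j => if j < m then ω j else ω' (j - m)

theorem glue_of_lt {n m j : ℕ} (ω ω' : ℕ → Fin n) (h : j < m) : glue m ω ω' j = ω j := by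
  simp [glue, h]

theorem glue_add {n m j : ℕ} (ω ω' : ℕ → Fin n) : glue m ω ω' (m + j) = ω' j := by
  simp [glue]

theorem measurable_glue {n : ℕ} (m : ℕ) :
    Measurable (fun q : (ℕ → Fin n) × (ℕ → Fin n) => glue m q.1 q.2) := by
  refine measurable_pi_lambda _ fun j => ?_
  by_cases h : j < m
  · simp only [glue, h, if_true]; fun_prop
  · simp only [glue, h, if_false]; fun_prop

theorem measurable_glue_right {n : ℕ} (m : ℕ) (ω : ℕ → Fin n) : Measurable (glue m ω) :=
  (measurable_glue m).comp (measurable_const.prodMk measurable_id)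

theorem measurePreserving_glue {n : ℕ} (q : Measure (Fin n)) [IsProbabilityMeasure q] (m : ℕ) :
    MeasurePreserving (fun z : (ℕ → Fin n) × (ℕ → Fin n) => glue m z.1 z.2)
      ((Measure.infinitePi fun _ => q).prod (Measure.infinitePi fun _ => q))
      (Measure.infinitePi fun _ => q) := by
  refine ⟨measurable_glue m, Measure.eq_infinitePi _ fun S B hB => ?_⟩
  rw [Measure.map_apply (measurable_glue m) (MeasurableSet.pi S.countable_toSet fun i _ => hB i)]
  have hpre : (fun z : (ℕ → Fin n) × (ℕ → Fin n) => glue m z.1 z.2) ⁻¹' (Set.pi S B) =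
      (Set.pi ((S.filter (· < m) : Finset ℕ) : Set ℕ) B) ×ˢ
      (Set.pi (((S.filter (¬ · < m)).image (· - m) : Finset ℕ) : Set ℕ) fun j => B (j + m)) := by
    ext ⟨ω, ω'⟩
    simp only [Set.mem_preimage, Set.mem_pi, Set.mem_prod, Finset.mem_coe, Finset.mem_filter,
      Finset.mem_image, glue]
    constructor
    · intro h
      refine ⟨fun i hi => by simpa [hi.2] using h i hi.1, ?_⟩
      rintro _ ⟨i, hi, rfl⟩
      have := h i hi.1
      rw [if_neg hi.2] at this
      rwa [Nat.sub_add_cancel (by omega)]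
    · rintro ⟨h1, h2⟩ i hi
      by_cases him : i < m
      · simpa [him] using h1 i ⟨hi, him⟩
      · have := h2 (i - m) ⟨i, ⟨hi, him⟩, rfl⟩
        rw [Nat.sub_add_cancel (by omega)] at this
        simpa [him] using this
  rw [hpre, Measure.prod_prod, Measure.infinitePi_pi _ fun i _ => hB i,
    Measure.infinitePi_pi _ fun i _ => hB _, Finset.prod_image,
    ← Finset.prod_filter_mul_prod_filter_not S (· < m)]
  · congr 1
    refine Finset.prod_congr rfl fun i hi => ?_
    rw [Nat.sub_add_cancel (by simpa using (Finset.mem_filter.1 hi).2)]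
  · intro i hi j hj hij
    have hi' := (Finset.mem_filter.1 hi).2
    have hj' := (Finset.mem_filter.1 hj).2
    replace hij : i - m = j - m := hij
    omega

theorem integral_glue {n : ℕ} (q : Measure (Fin n)) [IsProbabilityMeasure q] (m : ℕ)
    (F : (ℕ → Fin n) → ℂ) (hF : Measurable F) {C : ℝ} (hC : ∀ ω, ‖F ω‖ ≤ C) :
    ∫ ω, F ω ∂(Measure.infinitePi fun _ => q) =
      ∫ ω, ∫ ω', F (glue m ω ω') ∂(Measure.infinitePi fun _ => q)
        ∂(Measure.infinitePi fun _ => q) := by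
  rw [← (measurePreserving_glue q m).map_eq, integral_map (measurable_glue m).aemeasurable
    hF.aestronglyMeasurable, (measurePreserving_glue q m).map_eq, integral_prod]
  exact Integrable.of_bound (hF.comp (measurable_glue m)).aestronglyMeasurable C
    (Eventually.of_forall fun z => hC _)

theorem tendsto_average_of_squares (v : ℕ → ℂ) {C : ℝ} (hv : ∀ m, ‖v m‖ ≤ C)
    (hsq : Tendsto (fun r : ℕ => ‖∑ m ∈ Finset.range (r ^ 2), v m‖ ^ 2 / (r : ℝ) ^ 4)
      atTop (𝓝 0)) :
    Tendsto (fun M : ℕ => (M : ℂ)⁻¹ * ∑ m ∈ Finset.range M, v m) atTop (𝓝 0) := by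
  have hC : 0 ≤ C := (norm_nonneg _).trans (hv 0)
  have hsqrt : Tendsto Nat.sqrt atTop atTop :=
    tendsto_atTop_atTop.2 fun b => ⟨b ^ 2, fun a ha => Nat.le_sqrt'.2 ha⟩
  have h1 : Tendsto (fun r : ℕ => √(‖∑ m ∈ Finset.range (r ^ 2), v m‖ ^ 2 / (r : ℝ) ^ 4)
      + 2 * C * (r : ℝ)⁻¹) atTop (𝓝 0) := by
    have ha := (Real.continuous_sqrt.tendsto 0).comp hsq
    have hb := (tendsto_inv_atTop_nhds_zero_nat (𝕜 := ℝ)).const_mul (2 * C)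
    simpa using ha.add hb
  apply squeeze_zero_norm' _ (h1.comp hsqrt)
  filter_upwards [eventually_ge_atTop 1] with M hM
  simp only [Function.comp]
  set r := Nat.sqrt M with hr
  have hr1 : 1 ≤ r := Nat.le_sqrt.2 (by simpa using hM)
  have hr0 : (0 : ℝ) < r := by exact_mod_cast hr1
  have hrM : r ^ 2 ≤ M := Nat.sqrt_le' M
  have hMr : M ≤ r ^ 2 + 2 * r := by
    have := Nat.sqrt_le_add M
    rw [← hr] at this
    nlinarith
  have hdec : ∑ m ∈ Finset.range M, v m
      = ∑ m ∈ Finset.range (r ^ 2), v m + ∑ m ∈ Finset.Ico (r ^ 2) M, v m :=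
    (Finset.sum_range_add_sum_Ico v hrM).symm
  have h2 : ‖∑ m ∈ Finset.Ico (r ^ 2) M, v m‖ ≤ 2 * r * C := by
    refine (norm_sum_le_of_le _ fun m _ => hv m).trans ?_
    simp only [Finset.sum_const, Nat.card_Ico, nsmul_eq_mul]
    gcongr
    have : M - r ^ 2 ≤ 2 * r := by omega
    exact_mod_cast this
  have hs : √(‖∑ m ∈ Finset.range (r ^ 2), v m‖ ^ 2 / (r : ℝ) ^ 4)
      = ‖∑ m ∈ Finset.range (r ^ 2), v m‖ / (r : ℝ) ^ 2 := by
    rw [show (r : ℝ) ^ 4 = (r ^ 2) ^ 2 by ring, ← div_pow, Real.sqrt_sq (by positivity)]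
  rw [hs, norm_mul, norm_inv, Complex.norm_natCast, hdec]
  have hM2 : (r : ℝ) ^ 2 ≤ M := by exact_mod_cast hrM
  calc (M : ℝ)⁻¹ * ‖∑ m ∈ Finset.range (r ^ 2), v m + ∑ m ∈ Finset.Ico (r ^ 2) M, v m‖
      ≤ ((r : ℝ) ^ 2)⁻¹ * (‖∑ m ∈ Finset.range (r ^ 2), v m‖ + 2 * r * C) := by
        gcongr
        exact (norm_add_le _ _).trans (by gcongr)
    _ = _ := by field_simp

theorem ae_tendsto_average_of_second_moment {Ω : Type*} [MeasurableSpace Ω] (P : Measure Ω)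
    [IsProbabilityMeasure P] (V : ℕ → Ω → ℂ) (hV : ∀ m, Measurable (V m)) {C B : ℝ}
    (hC : ∀ m ω, ‖V m ω‖ ≤ C)
    (hB : ∀ M : ℕ, ∫ ω, ‖∑ m ∈ Finset.range M, V m ω‖ ^ 2 ∂P ≤ M * B) :
    ∀ᵐ ω ∂P, Tendsto (fun M : ℕ => (M : ℂ)⁻¹ * ∑ m ∈ Finset.range M, V m ω) atTop (𝓝 0) := by
  set f : ℕ → Ω → ℝ := fun r ω => ‖∑ m ∈ Finset.range (r ^ 2), V m ω‖ ^ 2 / (r : ℝ) ^ 4 with hf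
  have hfm : ∀ r, Measurable (f r) := fun r =>
    (((Finset.measurable_sum _ fun m _ => hV m).norm).pow_const 2).div_const _
  have hf0 : ∀ r ω, 0 ≤ f r ω := fun r ω => by positivity
  have hfb : ∀ r ω, ‖f r ω‖ ≤ ((r ^ 2 : ℕ) * C) ^ 2 / (r : ℝ) ^ 4 := fun r ω => by
    rw [Real.norm_of_nonneg (hf0 r ω)]
    simp only [hf]
    gcongr
    refine (norm_sum_le_of_le _ fun m _ => hC m ω).trans ?_
    simp
  have hint : ∀ r, ∫⁻ ω, ENNReal.ofReal (f r ω) ∂P ≤ ENNReal.ofReal (B * (1 / (r : ℝ) ^ 2)) := by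
    intro r
    rw [← ofReal_integral_eq_lintegral_ofReal
      (Integrable.of_bound (hfm r).aestronglyMeasurable _ (Eventually.of_forall (hfb r)))
      (Eventually.of_forall (hf0 r))]
    apply ENNReal.ofReal_le_ofReal
    simp only [hf]
    rw [integral_div]
    rcases Nat.eq_zero_or_pos r with rfl | hr
    · simp
    · have hr0 : (0 : ℝ) < r := by exact_mod_cast hr
      rw [div_le_iff₀ (by positivity)]
      refine (hB _).trans (le_of_eq ?_)
      push_cast
      field_simp
  have hB0 : 0 ≤ B := by
    have := hB 1
    have h0 : (0 : ℝ) ≤ ∫ ω, ‖∑ m ∈ Finset.range 1, V m ω‖ ^ 2 ∂P :=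
      integral_nonneg fun ω => by positivity
    simp only [Nat.cast_one, one_mul] at this
    linarith
  have hsum : ∫⁻ ω, ∑' r, ENNReal.ofReal (f r ω) ∂P ≠ ⊤ := by
    rw [lintegral_tsum fun r => (hfm r).ennreal_ofReal.aemeasurable]
    refine ne_top_of_le_ne_top ?_ (ENNReal.tsum_le_tsum hint)
    have hs : Summable fun r : ℕ => B * (1 / (r : ℝ) ^ 2) :=
      (Real.summable_one_div_nat_pow.2 (by norm_num)).mul_left B
    rw [← ENNReal.ofReal_tsum_of_nonneg (fun r => by positivity) hs]
    exact ENNReal.ofReal_ne_top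
  filter_upwards [ae_lt_top' (AEMeasurable.tsum
    fun r => (hfm r).ennreal_ofReal.aemeasurable) hsum] with ω hω
  refine tendsto_average_of_squares _ (fun m => hC m ω) ?_
  have h1 := ENNReal.tendsto_atTop_zero_of_tsum_ne_top hω.ne
  have h2 := (ENNReal.tendsto_toReal ENNReal.zero_ne_top).comp h1
  simpa [Function.comp_def, ENNReal.toReal_ofReal (hf0 _ ω)] using h2

/-- The correlation of `W M` with the preceding partial sum is bounded independently of `M`. -/
theorem norm_integral_sum_mul_conj_le {n : ℕ} (q : Measure (Fin n)) [IsProbabilityMeasure q]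
    (W : ℕ → (ℕ → Fin n) → ℂ) (hW : ∀ m, Measurable (W m)) {C ρ : ℝ} (hρ0 : 0 ≤ ρ) (hρ1 : ρ < 1)
    (hC : ∀ m ω, ‖W m ω‖ ≤ C)
    (hmean : ∀ m ω, ∫ ω', W m (glue (m + 1) ω ω') ∂(Measure.infinitePi fun _ => q) = 0)
    (hosc : ∀ m r ω ω', (∀ j < m + 1 + r, ω j = ω' j) → ‖W m ω - W m ω'‖ ≤ C * ρ ^ r) (M : ℕ) :
    ‖∫ ω, (∑ m ∈ Finset.range M, W m ω) * (starRingEnd ℂ) (W M ω)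
      ∂(Measure.infinitePi fun _ => q)‖ ≤ C * (1 - ρ)⁻¹ * C := by
  set P : Measure (ℕ → Fin n) := Measure.infinitePi fun _ => q
  set S : (ℕ → Fin n) → ℂ := fun ω => ∑ m ∈ Finset.range M, W m ω with hS
  have hSm : Measurable S := Finset.measurable_sum _ fun m _ => hW m
  have hconj : Measurable (starRingEnd ℂ) := Complex.continuous_conj.measurable
  have hSb : ∀ ω, ‖S ω‖ ≤ M * C := fun ω => by
    refine (norm_sum_le_of_le _ fun m _ => hC m ω).trans ?_
    simp
  by_cases hne : Nonempty (ℕ → Fin n)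
  swap
  · rw [not_nonempty_iff] at hne
    have : P = 0 := Measure.eq_zero_of_isEmpty P
    have h1 : P Set.univ = 1 := measure_univ
    simp [this] at h1
  have hC0 : 0 ≤ C := (norm_nonneg _).trans (hC 0 hne.some)
  rw [integral_glue q (M + 1) (fun ω => S ω * (starRingEnd ℂ) (W M ω))
    (hSm.mul (hconj.comp (hW M))) (C := M * C * C) (fun ω => by
      rw [norm_mul, RCLike.norm_conj]
      exact mul_le_mul (hSb ω) (hC M ω) (norm_nonneg _) (by positivity))]
  have hgl : ∀ ω : ℕ → Fin n, Measurable (glue (M + 1) ω) := measurable_glue_right (M + 1)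
  have hinner : ∀ ω, ∫ ω', S (glue (M + 1) ω ω') * (starRingEnd ℂ) (W M (glue (M + 1) ω ω')) ∂P
      = ∫ ω', (S (glue (M + 1) ω ω') - S ω) * (starRingEnd ℂ) (W M (glue (M + 1) ω ω')) ∂P := by
    intro ω
    have hz : ∫ ω', S ω * (starRingEnd ℂ) (W M (glue (M + 1) ω ω')) ∂P = 0 := by
      rw [integral_const_mul, integral_conj, hmean]
      simp
    simp_rw [sub_mul]
    rw [integral_sub, hz, sub_zero]
    · refine Integrable.of_bound ((hSm.comp (hgl ω)).mul
        (hconj.comp ((hW M).comp (hgl ω)))).aestronglyMeasurable (M * C * C)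
        (Eventually.of_forall fun ω' => ?_)
      rw [norm_mul, RCLike.norm_conj]
      exact mul_le_mul (hSb _) (hC M _) (norm_nonneg _) (by positivity)
    · refine Integrable.of_bound (measurable_const.mul
        (hconj.comp ((hW M).comp (hgl ω)))).aestronglyMeasurable (M * C * C)
        (Eventually.of_forall fun ω' => ?_)
      rw [norm_mul, RCLike.norm_conj]
      exact mul_le_mul (hSb _) (hC M _) (norm_nonneg _) (by positivity)
  have hdiff : ∀ ω ω', ‖S (glue (M + 1) ω ω') - S ω‖ ≤ C * (1 - ρ)⁻¹ := by
    intro ω ω'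
    simp only [hS]
    rw [← Finset.sum_sub_distrib]
    calc ‖∑ m ∈ Finset.range M, (W m (glue (M + 1) ω ω') - W m ω)‖
        ≤ ∑ m ∈ Finset.range M, C * ρ ^ (M - 1 - m) := by
          refine norm_sum_le_of_le _ fun m hm => hosc m _ _ _ fun j hj => glue_of_lt _ _ ?_
          have := Finset.mem_range.1 hm
          omega
      _ = C * ∑ m ∈ Finset.range M, ρ ^ m := by
          rw [Finset.sum_range_reflect (fun m => C * ρ ^ m) M, Finset.mul_sum]
      _ ≤ C * (1 - ρ)⁻¹ := by
          gcongr
          rw [← tsum_geometric_of_lt_one hρ0 hρ1]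
          exact (summable_geometric_of_lt_one hρ0 hρ1).sum_le_tsum _ fun i _ => by positivity
  refine (congrArg norm (integral_congr_ae (Eventually.of_forall hinner))).trans_le ?_
  have hbound : ∀ ω, ‖∫ ω', (S (glue (M + 1) ω ω') - S ω) *
      (starRingEnd ℂ) (W M (glue (M + 1) ω ω')) ∂P‖ ≤ C * (1 - ρ)⁻¹ * C := by
    intro ω
    have := norm_integral_le_of_norm_le_const (μ := P) (C := C * (1 - ρ)⁻¹ * C)
      (f := fun ω' => (S (glue (M + 1) ω ω') - S ω) *
        (starRingEnd ℂ) (W M (glue (M + 1) ω ω'))) (Eventually.of_forall fun ω' => by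
        rw [norm_mul, RCLike.norm_conj]
        have : 0 < 1 - ρ := by linarith
        exact mul_le_mul (hdiff _ _) (hC M _) (norm_nonneg _) (by positivity))
    simpa using this
  simpa using norm_integral_le_of_norm_le_const (μ := P) (Eventually.of_forall hbound)

/-- A strong law of large numbers for functions of an i.i.d. sequence that have zero conditional
mean given the past and depend exponentially little on the distant future. -/
theorem ae_tendsto_average_of_mean_zero {n : ℕ} (q : Measure (Fin n)) [IsProbabilityMeasure q]
    (W : ℕ → (ℕ → Fin n) → ℂ) (hW : ∀ m, Measurable (W m)) {C ρ : ℝ} (hρ0 : 0 ≤ ρ) (hρ1 : ρ < 1)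
    (hC : ∀ m ω, ‖W m ω‖ ≤ C)
    (hmean : ∀ m ω, ∫ ω', W m (glue (m + 1) ω ω') ∂(Measure.infinitePi fun _ => q) = 0)
    (hosc : ∀ m r ω ω', (∀ j < m + 1 + r, ω j = ω' j) → ‖W m ω - W m ω'‖ ≤ C * ρ ^ r) :
    ∀ᵐ ω ∂(Measure.infinitePi fun _ => q),
      Tendsto (fun M : ℕ => (M : ℂ)⁻¹ * ∑ m ∈ Finset.range M, W m ω) atTop (𝓝 0) := by
  refine ae_tendsto_average_of_second_moment _ W hW hC
    (B := C ^ 2 + 2 * (C * (1 - ρ)⁻¹ * C)) fun M => ?_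
  set P : Measure (ℕ → Fin n) := Measure.infinitePi fun _ => q
  induction M with
  | zero => simp
  | succ M ih =>
    set S : (ℕ → Fin n) → ℂ := fun ω => ∑ m ∈ Finset.range M, W m ω with hS
    have hSm : Measurable S := Finset.measurable_sum _ fun m _ => hW m
    have hconj : Measurable (starRingEnd ℂ) := Complex.continuous_conj.measurable
    have hSb : ∀ ω, ‖S ω‖ ≤ M * C := fun ω => by
      refine (norm_sum_le_of_le _ fun m _ => hC m ω).trans ?_
      simp
    have hexp : ∀ ω, ‖∑ m ∈ Finset.range (M + 1), W m ω‖ ^ 2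
        = ‖S ω‖ ^ 2 + ‖W M ω‖ ^ 2 + 2 * (S ω * (starRingEnd ℂ) (W M ω)).re := fun ω => by
      rw [Finset.sum_range_succ, ← Complex.normSq_eq_norm_sq, Complex.normSq_add,
        Complex.normSq_eq_norm_sq, Complex.normSq_eq_norm_sq]
    have hi1 : Integrable (fun ω => ‖S ω‖ ^ 2) P :=
      Integrable.of_bound (hSm.norm.pow_const 2).aestronglyMeasurable ((M * C) ^ 2)
        (Eventually.of_forall fun ω => by
          rw [Real.norm_of_nonneg (by positivity)]
          gcongr
          exact hSb ω)
    have hi2 : Integrable (fun ω => ‖W M ω‖ ^ 2) P :=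
      Integrable.of_bound ((hW M).norm.pow_const 2).aestronglyMeasurable (C ^ 2)
        (Eventually.of_forall fun ω => by
          rw [Real.norm_of_nonneg (by positivity)]
          gcongr
          exact hC M ω)
    have hi3 : Integrable (fun ω => S ω * (starRingEnd ℂ) (W M ω)) P :=
      Integrable.of_bound (hSm.mul (hconj.comp (hW M))).aestronglyMeasurable (M * C * C)
        (Eventually.of_forall fun ω => by
          rw [norm_mul, RCLike.norm_conj]
          exact mul_le_mul (hSb ω) (hC M ω) (norm_nonneg _)
            ((norm_nonneg _).trans (hSb ω)))
    simp_rw [hexp]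
    have hre : ∫ ω, (S ω * (starRingEnd ℂ) (W M ω)).re ∂P
        = (∫ ω, S ω * (starRingEnd ℂ) (W M ω) ∂P).re := integral_re hi3
    have hi3' : Integrable (fun ω => (S ω * (starRingEnd ℂ) (W M ω)).re) P := hi3.re
    rw [integral_add (f := fun ω => ‖S ω‖ ^ 2 + ‖W M ω‖ ^ 2) (hi1.add hi2) (hi3'.const_mul 2),
      integral_add hi1 hi2,
      integral_const_mul]
    have h2 : ∫ ω, ‖W M ω‖ ^ 2 ∂P ≤ C ^ 2 := by
      calc ∫ ω, ‖W M ω‖ ^ 2 ∂P ≤ ∫ _, C ^ 2 ∂P :=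
            integral_mono hi2 (integrable_const _) fun ω => by
              simp only
              gcongr
              exact hC M ω
        _ = C ^ 2 := by simp
    have h3 : (∫ ω, S ω * (starRingEnd ℂ) (W M ω) ∂P).re ≤ C * (1 - ρ)⁻¹ * C :=
      (Complex.re_le_norm _).trans
        (norm_integral_sum_mul_conj_le q W hW hρ0 hρ1 hC hmean hosc M)
    push_cast
    rw [← hre] at h3
    linarith

/-- The product of the contraction ratios along the first `m` letters. -/
noncomputable def ratioProd {n : ℕ} (s : Fin n → ℝ) (m : ℕ) (ω : ℕ → Fin n) : ℝ :=
  ∏ j ∈ Finset.range m, s (ω j)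

/-- The image of `0` under the composition of the maps coded by the first `m` letters. -/
noncomputable def codingPartial {n : ℕ} (s t : Fin n → ℝ) (m : ℕ) (ω : ℕ → Fin n) : ℝ :=
  ∑ j ∈ Finset.range m, ratioProd s j ω * t (ω j)

/-- The coding map of the iterated function system `x ↦ s i * x + t i`. -/
noncomputable def coding {n : ℕ} (s t : Fin n → ℝ) (ω : ℕ → Fin n) : ℝ :=
  ∑' j, ratioProd s j ω * t (ω j)

theorem measurable_ratioProd {n : ℕ} (s : Fin n → ℝ) (m : ℕ) : Measurable (ratioProd s m) :=
  Finset.measurable_prod _ fun j _ => (measurable_of_finite s).comp (measurable_pi_apply j)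

theorem measurable_codingPartial {n : ℕ} (s t : Fin n → ℝ) (m : ℕ) :
    Measurable (codingPartial s t m) :=
  Finset.measurable_sum _ fun j _ => (measurable_ratioProd s j).mul
    ((measurable_of_finite t).comp (measurable_pi_apply j))

theorem measurable_coding {n : ℕ} (s t : Fin n → ℝ) : Measurable (coding s t) :=
  Measurable.tsum fun j => (measurable_ratioProd s j).mul
    ((measurable_of_finite t).comp (measurable_pi_apply j))

theorem ratioProd_congr {n m : ℕ} (s : Fin n → ℝ) {ω ω' : ℕ → Fin n}
    (h : ∀ j < m, ω j = ω' j) : ratioProd s m ω = ratioProd s m ω' :=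
  Finset.prod_congr rfl fun j hj => by rw [h j (Finset.mem_range.1 hj)]

theorem codingPartial_congr {n m : ℕ} (s t : Fin n → ℝ) {ω ω' : ℕ → Fin n}
    (h : ∀ j < m, ω j = ω' j) : codingPartial s t m ω = codingPartial s t m ω' :=
  Finset.sum_congr rfl fun j hj => by
    rw [h j (Finset.mem_range.1 hj),
      ratioProd_congr s fun i hi => h i (hi.trans (Finset.mem_range.1 hj))]

theorem ratioProd_glue_add {n : ℕ} (s : Fin n → ℝ) (m j : ℕ) (ω ω' : ℕ → Fin n) :
    ratioProd s (m + j) (glue m ω ω') = ratioProd s m ω * ratioProd s j ω' := by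
  simp only [ratioProd]
  rw [Finset.prod_range_add]
  congr 1
  · exact Finset.prod_congr rfl fun i hi => by rw [glue_of_lt _ _ (Finset.mem_range.1 hi)]
  · exact Finset.prod_congr rfl fun i _ => by rw [glue_add]

theorem abs_ratioProd_le {n : ℕ} {s : Fin n → ℝ} {ρ : ℝ} (hs : ∀ i, |s i| ≤ ρ) (m : ℕ)
    (ω : ℕ → Fin n) : |ratioProd s m ω| ≤ ρ ^ m := by
  rw [ratioProd, Finset.abs_prod]
  refine (Finset.prod_le_prod (fun j _ => abs_nonneg _) fun j _ => hs (ω j)).trans ?_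
  simp

theorem norm_coding_term_le {n : ℕ} {s t : Fin n → ℝ} {ρ T : ℝ} (hρ0 : 0 ≤ ρ)
    (hs : ∀ i, |s i| ≤ ρ) (ht : ∀ i, |t i| ≤ T) (ω : ℕ → Fin n) (j : ℕ) :
    ‖ratioProd s j ω * t (ω j)‖ ≤ ρ ^ j * T := by
  rw [norm_mul]
  exact mul_le_mul (abs_ratioProd_le hs j ω) (ht _) (norm_nonneg _) (by positivity)

theorem summable_coding {n : ℕ} {s t : Fin n → ℝ} {ρ T : ℝ} (hρ0 : 0 ≤ ρ) (hρ1 : ρ < 1)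
    (hs : ∀ i, |s i| ≤ ρ) (ht : ∀ i, |t i| ≤ T) (ω : ℕ → Fin n) :
    Summable fun j => ratioProd s j ω * t (ω j) :=
  Summable.of_norm_bounded ((summable_geometric_of_lt_one hρ0 hρ1).mul_right T)
    (norm_coding_term_le hρ0 hs ht ω)

theorem abs_coding_le {n : ℕ} {s t : Fin n → ℝ} {ρ T : ℝ} (hρ0 : 0 ≤ ρ) (hρ1 : ρ < 1)
    (hs : ∀ i, |s i| ≤ ρ) (ht : ∀ i, |t i| ≤ T) (ω : ℕ → Fin n) :
    |coding s t ω| ≤ (1 - ρ)⁻¹ * T :=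
  tsum_of_norm_bounded ((hasSum_geometric_of_lt_one hρ0 hρ1).mul_right T)
    (norm_coding_term_le hρ0 hs ht ω)

theorem coding_glue {n : ℕ} {s t : Fin n → ℝ} {ρ T : ℝ} (hρ0 : 0 ≤ ρ) (hρ1 : ρ < 1)
    (hs : ∀ i, |s i| ≤ ρ) (ht : ∀ i, |t i| ≤ T) (m : ℕ) (ω ω' : ℕ → Fin n) :
    coding s t (glue m ω ω') = codingPartial s t m ω + ratioProd s m ω * coding s t ω' := by
  rw [coding, ← (summable_coding hρ0 hρ1 hs ht _).sum_add_tsum_nat_add m]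
  congr 1
  · exact codingPartial_congr s t fun j hj => glue_of_lt _ _ hj
  · rw [coding, ← tsum_mul_left]
    refine tsum_congr fun j => ?_
    rw [add_comm j m, ratioProd_glue_add, glue_add, mul_assoc]

theorem glue_self_shift {n : ℕ} (m : ℕ) (ω : ℕ → Fin n) : glue m ω (fun j => ω (m + j)) = ω := by
  funext j
  by_cases h : j < m
  · exact glue_of_lt _ _ h
  · obtain ⟨k, rfl⟩ := Nat.exists_eq_add_of_le (not_lt.1 h)
    rw [glue_add]

theorem abs_coding_sub_le {n : ℕ} {s t : Fin n → ℝ} {ρ T : ℝ} (hρ0 : 0 ≤ ρ) (hρ1 : ρ < 1)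
    (hs : ∀ i, |s i| ≤ ρ) (ht : ∀ i, |t i| ≤ T) {m : ℕ} {ω ω' : ℕ → Fin n}
    (h : ∀ j < m, ω j = ω' j) :
    |coding s t ω - coding s t ω'| ≤ |ratioProd s m ω| * (2 * ((1 - ρ)⁻¹ * T)) := by
  have h1 := coding_glue hρ0 hρ1 hs ht m ω fun j => ω (m + j)
  have h2 := coding_glue hρ0 hρ1 hs ht m ω' fun j => ω' (m + j)
  rw [glue_self_shift] at h1 h2
  rw [h1, h2, ← codingPartial_congr s t h, ← ratioProd_congr s h, add_sub_add_left_eq_sub,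
    ← mul_sub, abs_mul]
  gcongr
  refine (abs_sub _ _).trans ?_
  linarith [abs_coding_le hρ0 hρ1 hs ht fun j => ω (m + j),
    abs_coding_le hρ0 hρ1 hs ht fun j => ω' (m + j)]

/-- The probability measure on `Fin n` with weights `p`. -/
noncomputable def weightMeasure {n : ℕ} (p : Fin n → ℝ) : Measure (Fin n) :=
  ∑ i, ENNReal.ofReal (p i) • Measure.dirac i

theorem isProbabilityMeasure_weightMeasure {n : ℕ} {p : Fin n → ℝ} (hp : ∀ i, 0 < p i)
    (hpsum : ∑ i, p i = 1) : IsProbabilityMeasure (weightMeasure p) := by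
  constructor
  simp only [weightMeasure, Measure.coe_finsetSum, Finset.sum_apply, Measure.smul_apply,
    measure_univ, smul_eq_mul, mul_one]
  rw [← ENNReal.ofReal_sum_of_nonneg fun i _ => (hp i).le, hpsum, ENNReal.ofReal_one]

theorem integral_weightMeasure {n : ℕ} {p : Fin n → ℝ} (hp : ∀ i, 0 < p i) (f : Fin n → ℂ) :
    ∫ i, f i ∂(weightMeasure p) = ∑ i, (p i : ℂ) * f i := by
  rw [weightMeasure, integral_finsetSum_measure]
  · refine Finset.sum_congr rfl fun i _ => ?_
    rw [integral_smul_measure, integral_dirac, ENNReal.toReal_ofReal (hp i).le]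
    simp
  · intro i _
    exact (integrable_dirac (by simp)).smul_measure ENNReal.ofReal_ne_top

theorem integral_eval_zero {n : ℕ} {p : Fin n → ℝ} (hp : ∀ i, 0 < p i)
    [IsProbabilityMeasure (weightMeasure p)] (f : Fin n → ℂ) :
    ∫ ω, f (ω 0) ∂(Measure.infinitePi fun _ : ℕ => weightMeasure p) = ∑ i, (p i : ℂ) * f i := by
  have h := integral_map (μ := Measure.infinitePi fun _ : ℕ => weightMeasure p)
    (measurable_pi_apply 0).aemeasurable (measurable_of_finite f).aestronglyMeasurable
  have hmap := (measurePreserving_eval_infinitePi (fun _ : ℕ => weightMeasure p) 0).map_eq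
  rw [hmap, integral_weightMeasure hp] at h
  exact h.symm

/-- Two probability measures whose characteristic functions satisfy the same self-similarity
equation coincide. -/
theorem eq_of_charFun_selfSimilar {n : ℕ} {s t p : Fin n → ℝ} (hp : ∀ i, 0 < p i)
    (hpsum : ∑ i, p i = 1) {ρ : ℝ} (hρ0 : 0 < ρ) (hρ1 : ρ < 1) (hs : ∀ i, |s i| ≤ ρ)
    (μ ν : Measure ℝ) [IsProbabilityMeasure μ] [IsProbabilityMeasure ν]
    (hμ : ∀ ξ : ℝ, charFun μ ξ
      = ∑ i, (p i : ℂ) * (Complex.exp (ξ * t i * Complex.I) * charFun μ (ξ * s i)))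
    (hν : ∀ ξ : ℝ, charFun ν ξ
      = ∑ i, (p i : ℂ) * (Complex.exp (ξ * t i * Complex.I) * charFun ν (ξ * s i))) :
    μ = ν := by
  refine Measure.ext_of_charFun (funext fun ξ => ?_)
  refine eq_of_forall_dist_le fun ε hε => ?_
  have hc : ContinuousAt (fun ξ => charFun μ ξ - charFun ν ξ) 0 :=
    (continuous_charFun.sub continuous_charFun).continuousAt
  obtain ⟨δ, hδ, hball⟩ := Metric.continuousAt_iff.1 hc ε hε
  simp only [charFun_zero, probReal_univ, sub_self, dist_zero_right, Real.norm_eq_abs] at hball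
  have hind : ∀ k : ℕ, ∀ ξ : ℝ, |ξ| * ρ ^ k < δ → ‖charFun μ ξ - charFun ν ξ‖ ≤ ε := by
    intro k
    induction k with
    | zero => exact fun ξ hξ => (hball (by simpa using hξ)).le
    | succ k ih =>
      intro ξ hξ
      rw [hμ, hν, ← Finset.sum_sub_distrib]
      refine (norm_sum_le_of_le (n := fun i => p i * ε) _ fun i _ => ?_).trans ?_
      · rw [← mul_sub, ← mul_sub, norm_mul, norm_mul, Complex.norm_real, Real.norm_eq_abs,
          abs_of_pos (hp i), ← Complex.ofReal_mul, Complex.norm_exp_ofReal_mul_I, one_mul]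
        refine mul_le_mul_of_nonneg_left (ih _ (lt_of_le_of_lt ?_ hξ)) (hp i).le
        rw [abs_mul, pow_succ', mul_assoc]
        gcongr
        exact hs i
      · rw [← Finset.sum_mul, hpsum, one_mul]
  obtain ⟨k, hk⟩ := (((tendsto_pow_atTop_nhds_zero_of_lt_one hρ0.le hρ1).const_mul
    |ξ|).eventually_lt_const (by simpa using hδ)).exists
  rw [dist_eq_norm]
  exact hind k ξ hk

theorem charFun_selfSimilar {n : ℕ} {s t p : Fin n → ℝ} (hp : ∀ i, 0 < p i)
    (μ : Measure ℝ) [IsProbabilityMeasure μ]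
    (hself : μ = ∑ i, ENNReal.ofReal (p i) • Measure.map (fun x => s i * x + t i) μ) (ξ : ℝ) :
    charFun μ ξ = ∑ i, (p i : ℂ) * (Complex.exp (ξ * t i * Complex.I) * charFun μ (ξ * s i)) := by
  have hm : ∀ i, Measurable fun x : ℝ => s i * x + t i := fun i => by fun_prop
  have hcm : Measurable fun x : ℝ => Complex.exp (ξ * x * Complex.I) := by fun_prop
  have hi : ∀ (ν : Measure ℝ) [IsProbabilityMeasure ν],
      Integrable (fun x : ℝ => Complex.exp (ξ * x * Complex.I)) ν := fun ν _ =>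
    Integrable.of_bound hcm.aestronglyMeasurable 1 (Eventually.of_forall fun x => by
      rw [← Complex.ofReal_mul, Complex.norm_exp_ofReal_mul_I])
  conv_lhs => rw [charFun_apply_real, hself]
  rw [integral_finsetSum_measure]
  · refine Finset.sum_congr rfl fun i _ => ?_
    rw [integral_smul_measure, ENNReal.toReal_ofReal (hp i).le,
      integral_map (hm i).aemeasurable hcm.aestronglyMeasurable, charFun_apply_real,
      ← integral_const_mul, Complex.real_smul]
    congr 1
    refine integral_congr_ae (Eventually.of_forall fun x => ?_)
    simp only
    rw [← Complex.exp_add]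
    congr 1
    push_cast
    ring
  · intro i _
    have : IsProbabilityMeasure (Measure.map (fun x => s i * x + t i) μ) :=
      Measure.isProbabilityMeasure_map (hm i).aemeasurable
    exact (hi _).smul_measure ENNReal.ofReal_ne_top

/-- The coding map sends the Bernoulli measure to the self-similar measure. -/
theorem map_coding_eq {n : ℕ} {s t p : Fin n → ℝ} (hp : ∀ i, 0 < p i)
    (hpsum : ∑ i, p i = 1) [IsProbabilityMeasure (weightMeasure p)] {ρ T : ℝ} (hρ0 : 0 < ρ)
    (hρ1 : ρ < 1) (hs : ∀ i, |s i| ≤ ρ) (ht : ∀ i, |t i| ≤ T)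
    (μ : Measure ℝ) [IsProbabilityMeasure μ]
    (hself : μ = ∑ i, ENNReal.ofReal (p i) • Measure.map (fun x => s i * x + t i) μ) :
    Measure.map (coding s t) (Measure.infinitePi fun _ : ℕ => weightMeasure p) = μ := by
  have hprob : IsProbabilityMeasure
      (Measure.map (coding s t) (Measure.infinitePi fun _ : ℕ => weightMeasure p)) :=
    Measure.isProbabilityMeasure_map (measurable_coding s t).aemeasurable
  refine eq_of_charFun_selfSimilar hp hpsum hρ0 hρ1 hs _ _ (fun ξ => ?_)
    (charFun_selfSimilar hp μ hself)
  have hcm : ∀ ξ : ℝ, Measurable fun x : ℝ => Complex.exp (ξ * x * Complex.I) := fun ξ => by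
    fun_prop
  have hcf : ∀ ξ : ℝ, charFun (Measure.map (coding s t)
      (Measure.infinitePi fun _ : ℕ => weightMeasure p)) ξ =
      ∫ ω, Complex.exp (ξ * coding s t ω * Complex.I)
        ∂(Measure.infinitePi fun _ : ℕ => weightMeasure p) := fun ξ => by
    rw [charFun_apply_real, integral_map (measurable_coding s t).aemeasurable
      (hcm ξ).aestronglyMeasurable]
  rw [← integral_eval_zero hp fun i => Complex.exp (ξ * t i * Complex.I) *
    charFun (Measure.map (coding s t) (Measure.infinitePi fun _ : ℕ => weightMeasure p)) (ξ * s i),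
    hcf, integral_glue (weightMeasure p) 1 (fun ω => Complex.exp (ξ * coding s t ω * Complex.I))
      ((hcm ξ).comp (measurable_coding s t)) (C := 1)
      fun ω => by rw [← Complex.ofReal_mul, Complex.norm_exp_ofReal_mul_I]]
  refine integral_congr_ae (Eventually.of_forall fun ω => ?_)
  simp only
  rw [hcf, ← integral_const_mul]
  refine integral_congr_ae (Eventually.of_forall fun ω' => ?_)
  simp only
  rw [coding_glue hρ0.le hρ1 hs ht, ← Complex.exp_add]
  congr 1
  simp [codingPartial, ratioProd]
  ring


theorem charFun_map_sub_prod (μ : Measure ℝ) [IsProbabilityMeasure μ] (ξ : ℝ) :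
    charFun (Measure.map (fun z : ℝ × ℝ => z.1 - z.2) (μ.prod μ)) ξ
      = ((‖charFun μ ξ‖ ^ 2 : ℝ) : ℂ) := by
  have hm : Measurable fun z : ℝ × ℝ => z.1 - z.2 := by fun_prop
  rw [charFun_apply_real, integral_map hm.aemeasurable (by fun_prop)]
  have h : ∀ z : ℝ × ℝ, Complex.exp (ξ * ((z.1 - z.2 : ℝ) : ℂ) * Complex.I) =
      Complex.exp (ξ * z.1 * Complex.I) * Complex.exp ((-ξ : ℝ) * z.2 * Complex.I) := fun z => by
    rw [← Complex.exp_add]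
    congr 1
    push_cast
    ring
  simp_rw [h]
  rw [integral_prod_mul (fun x : ℝ => Complex.exp (ξ * x * Complex.I))
    (fun x : ℝ => Complex.exp ((-ξ : ℝ) * x * Complex.I)), ← charFun_apply_real,
    ← charFun_apply_real, charFun_neg, Complex.mul_conj']
  push_cast
  rfl

theorem map_sub_prod_singleton_zero {μ : Measure ℝ} [IsProbabilityMeasure μ]
    (hna : ∀ x : ℝ, μ {x} = 0) :
    Measure.map (fun z : ℝ × ℝ => z.1 - z.2) (μ.prod μ) {0} = 0 := by
  have hm : Measurable fun z : ℝ × ℝ => z.1 - z.2 := by fun_prop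
  rw [Measure.map_apply hm (measurableSet_singleton 0),
    Measure.prod_apply (hm (measurableSet_singleton 0))]
  refine (lintegral_congr fun x => ?_).trans lintegral_zero
  convert hna x
  ext y
  simp [sub_eq_zero, eq_comm]

/-- **Wiener's lemma** for a measure without atoms. -/
theorem tendsto_average_norm_charFun_sq {μ : Measure ℝ} [IsProbabilityMeasure μ]
    (hna : ∀ x : ℝ, μ {x} = 0) :
    Tendsto (fun c : ℝ => c⁻¹ * ∫ ξ in -c..c, ‖charFun μ ξ‖ ^ 2) atTop (𝓝 0) := by
  have hm : Measurable fun z : ℝ × ℝ => z.1 - z.2 := by fun_prop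
  set ν := Measure.map (fun z : ℝ × ℝ => z.1 - z.2) (μ.prod μ) with hν
  have : IsProbabilityMeasure ν := Measure.isProbabilityMeasure_map hm.aemeasurable
  have hlim : Tendsto (fun c : ℝ => ∫ x, Real.sinc (c * x) ∂ν) atTop (𝓝 (∫ _, (0 : ℝ) ∂ν)) := by
    refine tendsto_integral_filter_of_dominated_convergence (fun _ => 1)
      (Eventually.of_forall fun c => ?_) (Eventually.of_forall fun c =>
        Eventually.of_forall fun x => ?_) (integrable_const _) ?_
    · exact (Real.continuous_sinc.comp (by fun_prop)).aestronglyMeasurable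
    · exact Real.abs_sinc_le_one _
    · have h0 : ∀ᵐ x ∂ν, x ≠ 0 := measure_eq_zero_iff_ae_notMem.1 (map_sub_prod_singleton_zero hna)
      filter_upwards [h0] with x hx
      have hb : Tendsto (fun c : ℝ => |x|⁻¹ * c⁻¹) atTop (𝓝 0) := by
        simpa using tendsto_inv_atTop_zero.const_mul |x|⁻¹
      refine squeeze_zero_norm' ?_ hb
      filter_upwards [eventually_gt_atTop 0] with c hc
      rw [Real.sinc_of_ne_zero (mul_ne_zero hc.ne' hx), norm_div, Real.norm_eq_abs,
        Real.norm_eq_abs, abs_mul, abs_of_pos hc, div_eq_mul_inv, mul_inv, mul_comm |x|⁻¹]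
      exact mul_le_of_le_one_left (by positivity) (Real.abs_sin_le_one _)
  rw [integral_zero] at hlim
  have h2 := hlim.const_mul 2
  rw [mul_zero] at h2
  refine h2.congr' ?_
  filter_upwards [eventually_gt_atTop 0] with c hc
  have h := integral_charFun_Icc (μ := ν) hc
  simp_rw [hν, charFun_map_sub_prod, ← hν] at h
  rw [intervalIntegral.integral_ofReal] at h
  have h' : ∫ ξ in -c..c, ‖charFun μ ξ‖ ^ 2 = 2 * c * ∫ x, Real.sinc (c * x) ∂ν := by
    exact_mod_cast h
  rw [h']
  field_simp

theorem tendsto_integral_norm_charFun_rpow_sq {μ : Measure ℝ} [IsProbabilityMeasure μ]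
    (hna : ∀ x : ℝ, μ {x} = 0) {b : ℝ} (hb : 1 < b) :
    Tendsto (fun c : ℝ => ∫ v in (0 : ℝ)..1, ‖charFun μ (c * b ^ (-v))‖ ^ 2) atTop (𝓝 0) := by
  have hb0 : 0 < b := one_pos.trans hb
  have hlog : 0 < Real.log b := Real.log_pos hb
  have hφ : Continuous fun ξ => ‖charFun μ ξ‖ ^ 2 := by
    have := continuous_charFun (μ := μ); fun_prop
  have h2 := (tendsto_average_norm_charFun_sq hna).const_mul (b * (Real.log b)⁻¹)
  rw [mul_zero] at h2
  refine squeeze_zero' (Eventually.of_forall fun c =>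
    intervalIntegral.integral_nonneg zero_le_one fun v _ => by positivity) ?_ h2
  filter_upwards [eventually_gt_atTop 0] with c hc
  have hpow : Continuous fun v : ℝ => b ^ (-v) :=
    continuous_const.rpow continuous_neg fun _ => Or.inl hb0.ne'
  have hder : ∀ v : ℝ, HasDerivAt (fun v : ℝ => c * b ^ (-v)) (-(c * b ^ (-v) * Real.log b)) v := by
    intro v
    have h := ((hasDerivAt_neg v).const_rpow hb0).const_mul c
    exact h.congr_deriv (by ring)
  have hcv := intervalIntegral.integral_comp_mul_deriv (a := 0) (b := 1)
    (g := fun ξ => ‖charFun μ ξ‖ ^ 2) (fun v _ => hder v)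
    (by fun_prop : Continuous fun v : ℝ => -(c * b ^ (-v) * Real.log b)).continuousOn hφ
  have hmono : ∫ ξ in c * b ^ (-1 : ℝ)..c * b ^ (-0 : ℝ), ‖charFun μ ξ‖ ^ 2 ≤
      ∫ ξ in -c..c, ‖charFun μ ξ‖ ^ 2 := by
    have hb1 : b ^ (-1 : ℝ) ≤ 1 := Real.rpow_le_one_of_one_le_of_nonpos hb.le (by norm_num)
    have hb2 : 0 < b ^ (-1 : ℝ) := by positivity
    refine intervalIntegral.integral_mono_interval ?_ ?_ ?_
      (Eventually.of_forall fun ξ => by positivity) (hφ.intervalIntegrable _ _)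
    · nlinarith
    · simp only [neg_zero, Real.rpow_zero]; nlinarith
    · simp
  rw [intervalIntegral.integral_symm, ← hcv, ← intervalIntegral.integral_neg] at hmono
  calc ∫ v in (0 : ℝ)..1, ‖charFun μ (c * b ^ (-v))‖ ^ 2
      ≤ ∫ v in (0 : ℝ)..1, b * (Real.log b)⁻¹ * c⁻¹ *
        -(((fun ξ => ‖charFun μ ξ‖ ^ 2) ∘ fun v : ℝ => c * b ^ (-v)) v *
          -(c * b ^ (-v) * Real.log b)) := by
        refine intervalIntegral.integral_mono_on zero_le_one
          (Continuous.intervalIntegrable (hφ.comp (by fun_prop)) _ _)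
          (Continuous.intervalIntegrable ?_ _ _) fun v hv => ?_
        · have := hφ.comp (continuous_const.mul hpow : Continuous fun v : ℝ => c * b ^ (-v))
          fun_prop
        · have h1 : 1 ≤ b * b ^ (-v) := by
            nth_rewrite 1 [← Real.rpow_one b]
            rw [← Real.rpow_add hb0]
            exact Real.one_le_rpow hb.le (by linarith [hv.2])
          have h3 : b * (Real.log b)⁻¹ * c⁻¹ *
            -(((fun ξ => ‖charFun μ ξ‖ ^ 2) ∘ fun v : ℝ => c * b ^ (-v)) v *
              -(c * b ^ (-v) * Real.log b)) =
              ‖charFun μ (c * b ^ (-v))‖ ^ 2 * (b * b ^ (-v)) := by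
            simp only [Function.comp]
            field_simp
          rw [h3]
          exact le_mul_of_one_le_right (by positivity) h1
    _ ≤ _ := by
        rw [intervalIntegral.integral_const_mul, mul_assoc (b * _)]
        gcongr

theorem tendsto_integral_norm_charFun_rpow {μ : Measure ℝ} [IsProbabilityMeasure μ]
    (hna : ∀ x : ℝ, μ {x} = 0) {b : ℝ} (hb : 1 < b) :
    Tendsto (fun c : ℝ => ∫ v in (0 : ℝ)..1, ‖charFun μ (c * b ^ (-v))‖) atTop (𝓝 0) := by
  have hb0 : 0 < b := one_pos.trans hb
  have hpow : Continuous fun v : ℝ => b ^ (-v) :=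
    continuous_const.rpow continuous_neg fun _ => Or.inl hb0.ne'
  have hφ := continuous_charFun (μ := μ)
  refine Metric.tendsto_nhds.2 fun ε hε => ?_
  have hsq := (tendsto_integral_norm_charFun_rpow_sq hna hb).const_mul (ε / 2)⁻¹
  rw [mul_zero] at hsq
  filter_upwards [hsq.eventually_lt_const (half_pos hε)] with c hc
  rw [dist_zero_right, Real.norm_eq_abs, abs_of_nonneg
    (intervalIntegral.integral_nonneg zero_le_one fun v _ => norm_nonneg _)]
  have hcont : Continuous fun v : ℝ => ‖charFun μ (c * b ^ (-v))‖ :=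
    (hφ.comp (by fun_prop)).norm
  calc ∫ v in (0 : ℝ)..1, ‖charFun μ (c * b ^ (-v))‖
      ≤ ∫ v in (0 : ℝ)..1, (ε / 2 + (ε / 2)⁻¹ * ‖charFun μ (c * b ^ (-v))‖ ^ 2) := by
        refine intervalIntegral.integral_mono_on zero_le_one (hcont.intervalIntegrable _ _)
          (Continuous.intervalIntegrable (by fun_prop) _ _) fun v _ => ?_
        have h : ε / 2 * (ε / 2)⁻¹ = 1 := mul_inv_cancel₀ (by positivity)
        generalize ‖charFun μ (c * b ^ (-v))‖ = a at *
        have hd : 0 < (ε / 2)⁻¹ := by positivity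
        nlinarith [mul_nonneg hd.le (sq_nonneg (a - ε / 2)),
          mul_nonneg hd.le (sq_nonneg a), mul_nonneg hd.le (sq_nonneg (a - ε)),
          mul_comm (ε / 2) (ε / 2)⁻¹]
    _ = ε / 2 + (ε / 2)⁻¹ * ∫ v in (0 : ℝ)..1, ‖charFun μ (c * b ^ (-v))‖ ^ 2 := by
        rw [intervalIntegral.integral_add (by simp)
          (Continuous.intervalIntegrable (by fun_prop) _ _)]
        simp
    _ < ε := by linarith

/-- The partial sums of the values `a` along the letters of `ω`. -/
noncomputable def letterSum {n : ℕ} (a : Fin n → ℝ) (m : ℕ) (ω : ℕ → Fin n) : ℝ :=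
  ∑ j ∈ Finset.range m, a (ω j)

theorem measurable_letterSum {n : ℕ} (a : Fin n → ℝ) (m : ℕ) : Measurable (letterSum a m) :=
  Finset.measurable_sum _ fun j _ => (measurable_of_finite a).comp (measurable_pi_apply j)

theorem letterSum_succ {n : ℕ} (a : Fin n → ℝ) (m : ℕ) (ω : ℕ → Fin n) :
    letterSum a (m + 1) ω = letterSum a m ω + a (ω m) :=
  Finset.sum_range_succ _ _

theorem letterSum_congr {n m : ℕ} (a : Fin n → ℝ) {ω ω' : ℕ → Fin n}
    (h : ∀ j < m, ω j = ω' j) : letterSum a m ω = letterSum a m ω' :=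
  Finset.sum_congr rfl fun j hj => by rw [h j (Finset.mem_range.1 hj)]

theorem norm_exp_two_pi_I_mul (j : ℤ) (u : ℝ) :
    ‖Complex.exp (2 * Real.pi * Complex.I * j * u)‖ = 1 := by
  rw [show (2 * Real.pi * Complex.I * j * u : ℂ) = ((2 * Real.pi * j * u : ℝ) : ℂ) * Complex.I by
    push_cast; ring, Complex.norm_exp_ofReal_mul_I]

theorem sum_mul_exp_ne_one {n : ℕ} {p : Fin n → ℝ} (hp : ∀ i, 0 < p i) (hpsum : ∑ i, p i = 1)
    {a : Fin n → ℝ} {i : Fin n} (ha : Irrational (a i)) {j : ℤ} (hj : j ≠ 0) :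
    ∑ i, (p i : ℂ) * Complex.exp (2 * Real.pi * Complex.I * j * a i) ≠ 1 := by
  intro h
  have hre := congrArg Complex.re h
  have hterm : ∀ i, ((p i : ℂ) * Complex.exp (2 * Real.pi * Complex.I * j * a i)).re =
      p i * Real.cos (2 * Real.pi * j * a i) := fun i => by
    rw [show (2 * Real.pi * Complex.I * j * a i : ℂ) =
      ((2 * Real.pi * j * a i : ℝ) : ℂ) * Complex.I by push_cast; ring, Complex.re_ofReal_mul,
      Complex.exp_ofReal_mul_I_re]
  simp only [Complex.re_sum, hterm, Complex.one_re] at hre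
  have hz : ∑ i, p i * (1 - Real.cos (2 * Real.pi * j * a i)) = 0 := by
    simp only [mul_sub, mul_one, Finset.sum_sub_distrib, hre, hpsum, sub_self]
  have hi := (Finset.sum_eq_zero_iff_of_nonneg fun i _ => mul_nonneg (hp i).le
    (sub_nonneg.2 (Real.cos_le_one _))).1 hz i (Finset.mem_univ i)
  have hcos : Real.cos (2 * Real.pi * j * a i) = 1 := by
    rcases mul_eq_zero.1 hi with h0 | h0
    · exact absurd h0 (hp i).ne'
    · linarith
  obtain ⟨k, hk⟩ := (Real.cos_eq_one_iff _).1 hcos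
  refine ha ⟨(k : ℚ) / j, ?_⟩
  have hj' : (j : ℝ) ≠ 0 := by exact_mod_cast hj
  have hpi := Real.pi_pos
  push_cast
  rw [div_eq_iff hj']
  have : (2 * Real.pi) * ((k : ℝ) - a i * j) = 0 := by linarith
  rcases mul_eq_zero.1 this with h0 | h0 <;> linarith

theorem tendsto_average_of_tendsto_average_succ_sub {u : ℕ → ℂ} {C : ℝ} (hu : ∀ k, ‖u k‖ ≤ C)
    {φ : ℂ} (hφ : φ ≠ 1)
    (h : Tendsto (fun N : ℕ => (N : ℂ)⁻¹ * ∑ k ∈ Finset.range N, (u (k + 1) - φ * u k)) atTop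
      (𝓝 0)) :
    Tendsto (fun N : ℕ => (N : ℂ)⁻¹ * ∑ k ∈ Finset.range N, u k) atTop (𝓝 0) := by
  have hb : Tendsto (fun N : ℕ => (N : ℂ)⁻¹ * (u N - u 0)) atTop (𝓝 0) := by
    have h1 : Tendsto (fun N : ℕ => (N : ℝ)⁻¹ * (C + C)) atTop (𝓝 0) := by
      simpa using (tendsto_inv_atTop_nhds_zero_nat (𝕜 := ℝ)).mul_const (C + C)
    refine squeeze_zero_norm (fun N => ?_) h1
    rw [norm_mul, norm_inv, Complex.norm_natCast]
    gcongr
    exact (norm_sub_le _ _).trans (add_le_add (hu _) (hu _))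
  have h2 := (h.sub hb).const_mul (1 - φ)⁻¹
  rw [sub_zero, mul_zero] at h2
  refine h2.congr fun N => ?_
  have hs : ∑ k ∈ Finset.range N, u (k + 1) = ∑ k ∈ Finset.range N, u k + (u N - u 0) := by
    rw [← Finset.sum_range_sub u, ← Finset.sum_add_distrib]
    exact Finset.sum_congr rfl fun k _ => by ring
  have h0 : 1 - φ ≠ 0 := sub_ne_zero.2 hφ.symm
  rw [Finset.sum_sub_distrib, ← Finset.mul_sum, hs]
  field_simp
  ring

theorem ae_tendsto_average_exp_letterSum {n : ℕ} {p : Fin n → ℝ} (hp : ∀ i, 0 < p i)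
    (hpsum : ∑ i, p i = 1) [IsProbabilityMeasure (weightMeasure p)]
    {a : Fin n → ℝ} {i : Fin n} (ha : Irrational (a i)) {j : ℤ} (hj : j ≠ 0) :
    ∀ᵐ ω ∂(Measure.infinitePi fun _ : ℕ => weightMeasure p),
      Tendsto (fun N : ℕ => (N : ℂ)⁻¹ * ∑ k ∈ Finset.range N,
        Complex.exp (2 * Real.pi * Complex.I * j * letterSum a (k + 1) ω)) atTop (𝓝 0) := by
  set E : ℝ → ℂ := fun u => Complex.exp (2 * Real.pi * Complex.I * j * u) with hE
  have hEm : Measurable E := by fun_prop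
  have hEn : ∀ u, ‖E u‖ = 1 := norm_exp_two_pi_I_mul j
  have hEa : ∀ u v : ℝ, E (u + v) = E u * E v := fun u v => by
    rw [hE]
    simp only
    rw [← Complex.exp_add]
    congr 1
    push_cast
    ring
  set φ : ℂ := ∑ i, (p i : ℂ) * E (a i) with hφ
  have hφ1 : φ ≠ 1 := sum_mul_exp_ne_one hp hpsum ha hj
  have hφn : ‖φ‖ ≤ 1 := by
    rw [← hpsum]
    refine norm_sum_le_of_le _ fun i _ => ?_
    rw [norm_mul, hEn, mul_one, Complex.norm_real, Real.norm_eq_abs, abs_of_pos (hp i)]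
  have hVn : ∀ m ω, ‖E (letterSum a (m + 2) ω) - φ * E (letterSum a (m + 1) ω)‖ ≤ 2 := by
    intro m ω
    refine (norm_sub_le _ _).trans ?_
    rw [norm_mul, hEn, hEn]
    linarith
  have key := ae_tendsto_average_of_mean_zero (weightMeasure p)
    (fun m ω => E (letterSum a (m + 2) ω) - φ * E (letterSum a (m + 1) ω))
    (fun m => (hEm.comp (measurable_letterSum a _)).sub
      (measurable_const.mul (hEm.comp (measurable_letterSum a _))))
    (ρ := 1 / 2) (C := 4) (by norm_num) (by norm_num)
    (fun m ω => (hVn m ω).trans (by norm_num)) (fun m ω => ?_) (fun m r ω ω' h => ?_)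
  · filter_upwards [key] with ω hω
    exact tendsto_average_of_tendsto_average_succ_sub (C := 1)
      (fun k => (hEn (letterSum a (k + 1) ω)).le) hφ1 hω
  · have h1 : ∀ ω' : ℕ → Fin n, letterSum a (m + 1) (glue (m + 1) ω ω') = letterSum a (m + 1) ω :=
      fun ω' => letterSum_congr a fun j hj => glue_of_lt _ _ hj
    have h2 : ∀ ω' : ℕ → Fin n, letterSum a (m + 2) (glue (m + 1) ω ω') =
        letterSum a (m + 1) ω + a (ω' 0) := fun ω' => by
      rw [letterSum_succ, h1]
      congr 2
      exact glue_add (m := m + 1) (j := 0) ω ω'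
    simp only [h1, h2, hEa]
    rw [integral_eval_zero hp fun i => E (letterSum a (m + 1) ω) * E (a i) -
      φ * E (letterSum a (m + 1) ω)]
    have h3 : ∑ i, (p i : ℂ) = 1 := by exact_mod_cast congrArg Complex.ofReal hpsum
    calc ∑ i, (p i : ℂ) * (E (letterSum a (m + 1) ω) * E (a i) - φ * E (letterSum a (m + 1) ω))
        = E (letterSum a (m + 1) ω) * ∑ i, (p i : ℂ) * E (a i) -
          φ * E (letterSum a (m + 1) ω) * ∑ i, (p i : ℂ) := by
          rw [Finset.mul_sum, Finset.mul_sum, ← Finset.sum_sub_distrib]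
          exact Finset.sum_congr rfl fun i _ => by ring
      _ = 0 := by rw [h3, ← hφ]; ring
  · rcases Nat.eq_zero_or_pos r with rfl | hr
    · refine (norm_sub_le _ _).trans ?_
      linarith [hVn m ω, hVn m ω']
    · rw [letterSum_congr a fun j hj => h j (by omega),
        letterSum_congr (m := m + 1) a fun j hj => h j (by omega), sub_self, norm_zero]
      positivity

theorem ae_tendsto_average_fract_letterSum {n : ℕ} {p : Fin n → ℝ} (hp : ∀ i, 0 < p i)
    (hpsum : ∑ i, p i = 1) [IsProbabilityMeasure (weightMeasure p)]
    {a : Fin n → ℝ} {i : Fin n} (ha : Irrational (a i)) :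
    ∀ᵐ ω ∂(Measure.infinitePi fun _ : ℕ => weightMeasure p), ∀ g : ℝ → ℝ, Continuous g →
      Tendsto (fun N : ℕ => (N : ℝ)⁻¹ * ∑ k ∈ Finset.range N,
        g (Int.fract (letterSum a (k + 1) ω))) atTop (𝓝 (∫ u in (0 : ℝ)..1, g u)) := by
  have h : ∀ᵐ ω ∂(Measure.infinitePi fun _ : ℕ => weightMeasure p), ∀ j : ℤ, j ≠ 0 →
      Tendsto (fun N : ℕ => (N : ℂ)⁻¹ * ∑ k ∈ Finset.range N,
        Complex.exp (2 * Real.pi * Complex.I * j * letterSum a (k + 1) ω)) atTop (𝓝 0) :=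
    ae_all_iff.2 fun j => by
      by_cases hj : j = 0
      · exact Eventually.of_forall fun ω h => absurd hj h
      · filter_upwards [ae_tendsto_average_exp_letterSum hp hpsum ha hj] with ω hω _ using hω
  filter_upwards [h] with ω hω g hg
  exact weyl_fract _ hω g hg

/-- The exponent `a` with `|s i| = b ^ (-a)`. -/
noncomputable def contractionExponent {n : ℕ} (b : ℝ) (s : Fin n → ℝ) (i : Fin n) : ℝ :=
  -(Real.log |s i| / Real.log b)

theorem abs_ratioProd_eq_rpow {n : ℕ} {b : ℝ} (hb : 1 < b) {s : Fin n → ℝ} (hs0 : ∀ i, s i ≠ 0)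
    (m : ℕ) (ω : ℕ → Fin n) :
    |ratioProd s m ω| = b ^ (-letterSum (contractionExponent b s) m ω) := by
  have hb0 : 0 < b := one_pos.trans hb
  rw [ratioProd, Finset.abs_prod, letterSum, ← Finset.sum_neg_distrib, Real.rpow_sum_of_pos hb0]
  refine Finset.prod_congr rfl fun j _ => ?_
  rw [contractionExponent, neg_neg, Real.rpow_def_of_pos hb0,
    mul_div_cancel₀ _ (Real.log_pos hb).ne', Real.exp_log (abs_pos.2 (hs0 _))]

theorem letterSum_nonneg {n : ℕ} {a : Fin n → ℝ} (ha : ∀ i, 0 ≤ a i) (m : ℕ) (ω : ℕ → Fin n) :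
    0 ≤ letterSum a m ω :=
  Finset.sum_nonneg fun _ _ => ha _

/-- The times `k` with `b ^ (-k)` between the sizes of the cylinders of length `m` and `m + 1`. -/
noncomputable def timeBlock {n : ℕ} (a : Fin n → ℝ) (m : ℕ) (ω : ℕ → Fin n) : Finset ℕ :=
  Finset.Ico ⌊letterSum a m ω⌋₊ ⌊letterSum a (m + 1) ω⌋₊

theorem timeBlock_congr {n m : ℕ} (a : Fin n → ℝ) {ω ω' : ℕ → Fin n}
    (h : ∀ j < m + 1, ω j = ω' j) : timeBlock a m ω = timeBlock a m ω' := by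
  rw [timeBlock, timeBlock, letterSum_congr a h,
    letterSum_congr (m := m) a fun j hj => h j (by omega)]

theorem floor_letterSum_succ_le {n : ℕ} {a : Fin n → ℝ} (ha : ∀ i, 0 ≤ a i) {K : ℕ}
    (hK : ∀ i, a i ≤ K) (m : ℕ) (ω : ℕ → Fin n) :
    ⌊letterSum a (m + 1) ω⌋₊ ≤ ⌊letterSum a m ω⌋₊ + K := by
  rw [← Nat.floor_add_natCast (letterSum_nonneg ha m ω), letterSum_succ]
  exact Nat.floor_mono (by linarith [hK (ω m)])

theorem card_timeBlock_le {n : ℕ} {a : Fin n → ℝ} (ha : ∀ i, 0 ≤ a i) {K : ℕ}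
    (hK : ∀ i, a i ≤ K) (m : ℕ) (ω : ℕ → Fin n) : (timeBlock a m ω).card ≤ K := by
  rw [timeBlock, Nat.card_Ico]
  have := floor_letterSum_succ_le ha hK m ω
  omega

theorem measurable_sum_timeBlock {n : ℕ} (a : Fin n → ℝ) (m : ℕ) {F : ℕ → (ℕ → Fin n) → ℂ}
    (hF : ∀ k, Measurable (F k)) : Measurable fun ω => ∑ k ∈ timeBlock a m ω, F k ω := by
  have h : Measurable fun z : (ℕ × ℕ) × (ℕ → Fin n) => ∑ k ∈ Finset.Ico z.1.1 z.1.2, F k z.2 :=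
    measurable_from_prod_countable_right fun z =>
      Finset.measurable_sum (Finset.Ico z.1 z.2) fun k _ => hF k
  exact h.comp (((Nat.measurable_floor.comp (measurable_letterSum a m)).prodMk
    (Nat.measurable_floor.comp (measurable_letterSum a (m + 1)))).prodMk measurable_id)

theorem pow_mul_abs_ratioProd_le_one {n : ℕ} {b : ℝ} (hb : 1 < b) {s : Fin n → ℝ}
    (hs0 : ∀ i, s i ≠ 0) (ha : ∀ i, 0 ≤ contractionExponent b s i) {m k : ℕ} {ω : ℕ → Fin n}
    (hk : k ∈ timeBlock (contractionExponent b s) m ω) : b ^ k * |ratioProd s (m + 1) ω| ≤ 1 := by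
  have hb0 : 0 < b := one_pos.trans hb
  rw [abs_ratioProd_eq_rpow hb hs0, ← Real.rpow_natCast, ← Real.rpow_add hb0]
  refine Real.rpow_le_one_of_one_le_of_nonpos hb.le ?_
  have h1 : (k : ℝ) ≤ (⌊letterSum (contractionExponent b s) (m + 1) ω⌋₊ : ℝ) :=
    by exact_mod_cast (Finset.mem_Ico.1 hk).2.le
  have h2 := Nat.floor_le (letterSum_nonneg ha (m + 1) ω)
  linarith

/-- The part of the exponential sum at frequency `c` belonging to the `m`-th block of times. -/
noncomputable def expBlock {n : ℕ} (b c : ℝ) (s t : Fin n → ℝ) (m : ℕ) (ω : ℕ → Fin n) : ℂ :=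
  ∑ k ∈ timeBlock (contractionExponent b s) m ω,
    Complex.exp ((c * b ^ k * coding s t ω : ℝ) * Complex.I)

/-- The conditional expectation of `expBlock` given the first `m + 1` letters. -/
noncomputable def expBlockMean {n : ℕ} (μ : Measure ℝ) (b c : ℝ) (s t : Fin n → ℝ) (m : ℕ)
    (ω : ℕ → Fin n) : ℂ :=
  ∑ k ∈ timeBlock (contractionExponent b s) m ω,
    Complex.exp ((c * b ^ k * codingPartial s t (m + 1) ω : ℝ) * Complex.I) *
      charFun μ (c * b ^ k * ratioProd s (m + 1) ω)

theorem norm_exp_ofReal_mul_I_sub_le (x y : ℝ) :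
    ‖Complex.exp (x * Complex.I) - Complex.exp (y * Complex.I)‖ ≤ |x - y| := by
  have h : Complex.exp (x * Complex.I) - Complex.exp (y * Complex.I) =
      Complex.exp (y * Complex.I) * (Complex.exp (Complex.I * ((x - y : ℝ) : ℂ)) - 1) := by
    rw [mul_sub, mul_one, ← Complex.exp_add]
    congr 2
    push_cast
    ring
  rw [h, norm_mul, Complex.norm_exp_ofReal_mul_I, one_mul]
  exact Real.norm_exp_I_mul_ofReal_sub_one_le

theorem norm_expBlock_le {n : ℕ} {b : ℝ} {s : Fin n → ℝ}
    (ha : ∀ i, 0 ≤ contractionExponent b s i) {K : ℕ} (hK : ∀ i, contractionExponent b s i ≤ K)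
    (c : ℝ) (t : Fin n → ℝ) (m : ℕ) (ω : ℕ → Fin n) : ‖expBlock b c s t m ω‖ ≤ K := by
  refine (norm_sum_le_of_le (n := fun _ => 1) _ fun k _ => ?_).trans ?_
  · rw [Complex.norm_exp_ofReal_mul_I]
  · simpa using card_timeBlock_le ha hK m ω

theorem norm_expBlockMean_le {n : ℕ} (μ : Measure ℝ) [IsProbabilityMeasure μ] {b : ℝ}
    {s : Fin n → ℝ} (ha : ∀ i, 0 ≤ contractionExponent b s i) {K : ℕ}
    (hK : ∀ i, contractionExponent b s i ≤ K)
    (c : ℝ) (t : Fin n → ℝ) (m : ℕ) (ω : ℕ → Fin n) : ‖expBlockMean μ b c s t m ω‖ ≤ K := by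
  refine (norm_sum_le_of_le (n := fun _ => 1) _ fun k _ => ?_).trans ?_
  · rw [norm_mul, Complex.norm_exp_ofReal_mul_I, one_mul]
    exact norm_charFun_le_one _
  · simpa using card_timeBlock_le ha hK m ω

theorem measurable_expBlock {n : ℕ} (b c : ℝ) (s t : Fin n → ℝ) (m : ℕ) :
    Measurable (expBlock b c s t m) :=
  measurable_sum_timeBlock _ m fun k => by
    have := measurable_coding s t
    fun_prop

theorem measurable_expBlockMean {n : ℕ} (μ : Measure ℝ) [IsProbabilityMeasure μ] (b c : ℝ)
    (s t : Fin n → ℝ) (m : ℕ) : Measurable (expBlockMean μ b c s t m) :=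
  measurable_sum_timeBlock _ m fun k => by
    have h1 := measurable_codingPartial s t (m + 1)
    have h2 := measurable_ratioProd s (m + 1)
    have h3 := (continuous_charFun (μ := μ)).measurable
    exact (by fun_prop : Measurable fun ω => Complex.exp
      ((c * b ^ k * codingPartial s t (m + 1) ω : ℝ) * Complex.I)).mul
      (h3.comp (by fun_prop))

theorem integral_expBlock_sub_expBlockMean {n : ℕ} {p : Fin n → ℝ}
    [IsProbabilityMeasure (weightMeasure p)] {s t : Fin n → ℝ} {ρ T : ℝ} (hρ0 : 0 < ρ)
    (hρ1 : ρ < 1) (hs : ∀ i, |s i| ≤ ρ) (ht : ∀ i, |t i| ≤ T) (μ : Measure ℝ)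
    (hmap : Measure.map (coding s t) (Measure.infinitePi fun _ : ℕ => weightMeasure p) = μ)
    (b c : ℝ) (m : ℕ) (ω : ℕ → Fin n) :
    ∫ ω', (expBlock b c s t m (glue (m + 1) ω ω') - expBlockMean μ b c s t m (glue (m + 1) ω ω'))
      ∂(Measure.infinitePi fun _ : ℕ => weightMeasure p) = 0 := by
  set P := Measure.infinitePi fun _ : ℕ => weightMeasure p with hP
  have hagree : ∀ ω' : ℕ → Fin n, ∀ j < m + 1, glue (m + 1) ω ω' j = ω j := fun ω' j hj =>
    glue_of_lt _ _ hj
  have hcm := measurable_coding s t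
  have hexp : ∀ ω', expBlock b c s t m (glue (m + 1) ω ω') -
      expBlockMean μ b c s t m (glue (m + 1) ω ω') =
      ∑ k ∈ timeBlock (contractionExponent b s) m ω,
        Complex.exp ((c * b ^ k * codingPartial s t (m + 1) ω : ℝ) * Complex.I) *
        (Complex.exp ((c * b ^ k * ratioProd s (m + 1) ω : ℝ) * coding s t ω' * Complex.I) -
          charFun μ (c * b ^ k * ratioProd s (m + 1) ω)) := by
    intro ω'
    rw [expBlock, expBlockMean, timeBlock_congr _ (hagree ω'), codingPartial_congr s t (hagree ω'),
      ratioProd_congr s (hagree ω'), ← Finset.sum_sub_distrib]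
    refine Finset.sum_congr rfl fun k _ => ?_
    rw [coding_glue hρ0.le hρ1 hs ht, mul_sub, ← Complex.exp_add]
    congr 2
    push_cast
    ring
  have hint : ∀ ξ : ℝ, Integrable (fun ω' => Complex.exp (ξ * coding s t ω' * Complex.I)) P :=
    fun ξ => Integrable.of_bound (by fun_prop) 1 (Eventually.of_forall fun ω' => by
      rw [← Complex.ofReal_mul, Complex.norm_exp_ofReal_mul_I])
  rw [integral_congr_ae (Eventually.of_forall hexp), integral_finsetSum]
  swap
  · exact fun k _ => ((hint _).sub (integrable_const _)).const_mul _
  refine Finset.sum_eq_zero fun k _ => ?_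
  have hcf : ∫ ω', Complex.exp ((c * b ^ k * ratioProd s (m + 1) ω : ℝ) * coding s t ω' *
      Complex.I) ∂P = charFun μ (c * b ^ k * ratioProd s (m + 1) ω) := by
    rw [charFun_apply_real, ← hmap, integral_map hcm.aemeasurable (by fun_prop)]
  rw [integral_const_mul, integral_sub (hint _) (integrable_const _), hcf]
  simp

theorem norm_expBlock_sub_le {n : ℕ} {b : ℝ} (hb : 1 < b) {s t : Fin n → ℝ}
    (hs0 : ∀ i, s i ≠ 0) (ha : ∀ i, 0 ≤ contractionExponent b s i) {K : ℕ}
    (hK : ∀ i, contractionExponent b s i ≤ K) {ρ T : ℝ} (hρ0 : 0 < ρ) (hρ1 : ρ < 1)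
    (hs : ∀ i, |s i| ≤ ρ) (ht : ∀ i, |t i| ≤ T) (hT : 0 ≤ T) (c : ℝ) {m r : ℕ} {ω ω' : ℕ → Fin n}
    (h : ∀ j < m + 1 + r, ω j = ω' j) :
    ‖expBlock b c s t m ω - expBlock b c s t m ω'‖ ≤
      K * (|c| * (2 * ((1 - ρ)⁻¹ * T))) * ρ ^ r := by
  have hR : 0 ≤ 2 * ((1 - ρ)⁻¹ * T) := by
    have : 0 < 1 - ρ := by linarith
    positivity
  rw [expBlock, expBlock, ← timeBlock_congr _ fun j hj => h j (by omega),
    ← Finset.sum_sub_distrib]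
  refine (norm_sum_le_of_le (n := fun _ => |c| * (2 * ((1 - ρ)⁻¹ * T)) * ρ ^ r) _
    fun k hk => ?_).trans ?_
  · refine (norm_exp_ofReal_mul_I_sub_le _ _).trans ?_
    rw [← mul_sub, abs_mul, abs_mul, abs_of_pos (by positivity : 0 < b ^ k)]
    have h1 := abs_coding_sub_le hρ0.le hρ1 hs ht h
    have h2 : |ratioProd s (m + 1 + r) ω| ≤ |ratioProd s (m + 1) ω| * ρ ^ r := by
      have := ratioProd_glue_add s (m + 1) r ω fun j => ω (m + 1 + j)
      rw [glue_self_shift] at this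
      rw [this, abs_mul]
      gcongr
      exact abs_ratioProd_le hs _ _
    have h3 := pow_mul_abs_ratioProd_le_one hb hs0 ha hk
    calc |c| * b ^ k * |coding s t ω - coding s t ω'|
        ≤ |c| * b ^ k * (|ratioProd s (m + 1) ω| * ρ ^ r * (2 * ((1 - ρ)⁻¹ * T))) := by
          gcongr
          exact h1.trans (by gcongr)
      _ = |c| * (2 * ((1 - ρ)⁻¹ * T)) * ρ ^ r * (b ^ k * |ratioProd s (m + 1) ω|) := by ring
      _ ≤ |c| * (2 * ((1 - ρ)⁻¹ * T)) * ρ ^ r := mul_le_of_le_one_right (by positivity) h3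
  · rw [Finset.sum_const, nsmul_eq_mul, ← mul_assoc]
    gcongr
    exact card_timeBlock_le ha hK m ω

theorem expBlockMean_congr {n : ℕ} (μ : Measure ℝ) (b c : ℝ) (s t : Fin n → ℝ) {m : ℕ}
    {ω ω' : ℕ → Fin n} (h : ∀ j < m + 1, ω j = ω' j) :
    expBlockMean μ b c s t m ω = expBlockMean μ b c s t m ω' := by
  rw [expBlockMean, expBlockMean, timeBlock_congr _ h, codingPartial_congr s t h,
    ratioProd_congr s h]

theorem ae_tendsto_average_expBlock_sub {n : ℕ} {p : Fin n → ℝ}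
    [IsProbabilityMeasure (weightMeasure p)] {b : ℝ} (hb : 1 < b) {s t : Fin n → ℝ}
    (hs0 : ∀ i, s i ≠ 0) (ha : ∀ i, 0 ≤ contractionExponent b s i) {K : ℕ}
    (hK : ∀ i, contractionExponent b s i ≤ K) {ρ T : ℝ} (hρ0 : 0 < ρ)
    (hρ1 : ρ < 1) (hs : ∀ i, |s i| ≤ ρ) (ht : ∀ i, |t i| ≤ T) (hT : 0 ≤ T) (μ : Measure ℝ)
    [IsProbabilityMeasure μ]
    (hmap : Measure.map (coding s t) (Measure.infinitePi fun _ : ℕ => weightMeasure p) = μ)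
    (c : ℝ) :
    ∀ᵐ ω ∂(Measure.infinitePi fun _ : ℕ => weightMeasure p),
      Tendsto (fun M : ℕ => (M : ℂ)⁻¹ * ∑ m ∈ Finset.range M,
        (expBlock b c s t m ω - expBlockMean μ b c s t m ω)) atTop (𝓝 0) := by
  have hR : 0 ≤ K * (|c| * (2 * ((1 - ρ)⁻¹ * T))) := by
    have : 0 < 1 - ρ := by linarith
    positivity
  refine ae_tendsto_average_of_mean_zero (weightMeasure p) _
    (fun m => (measurable_expBlock b c s t m).sub (measurable_expBlockMean μ b c s t m))
    hρ0.le hρ1 (C := K + K + K * (|c| * (2 * ((1 - ρ)⁻¹ * T)))) (fun m ω => ?_)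
    (integral_expBlock_sub_expBlockMean hρ0 hρ1 hs ht μ hmap b c) (fun m r ω ω' h => ?_)
  · exact (norm_sub_le _ _).trans ((add_le_add (norm_expBlock_le ha hK c t m ω)
      (norm_expBlockMean_le μ ha hK c t m ω)).trans (le_add_of_nonneg_right hR))
  · rw [expBlockMean_congr μ b c s t fun j hj => h j (by omega), sub_sub_sub_cancel_right]
    refine (norm_expBlock_sub_le hb hs0 ha hK hρ0 hρ1 hs ht hT c h).trans ?_
    gcongr
    exact le_add_of_nonneg_left (by positivity)

theorem norm_charFun_abs (μ : Measure ℝ) (ξ : ℝ) : ‖charFun μ |ξ|‖ = ‖charFun μ ξ‖ := by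
  rcases abs_choice ξ with h | h <;> rw [h]
  rw [charFun_neg, RCLike.norm_conj]

theorem norm_expBlockMean_le_sum_charFun {n : ℕ} (μ : Measure ℝ) [IsProbabilityMeasure μ] {b : ℝ}
    (hb : 1 < b) {s : Fin n → ℝ} (hs0 : ∀ i, s i ≠ 0) (ha : ∀ i, 0 ≤ contractionExponent b s i)
    {K : ℕ} (hK : ∀ i, contractionExponent b s i ≤ K) (c : ℝ) (t : Fin n → ℝ) (m : ℕ)
    (ω : ℕ → Fin n) :
    ‖expBlockMean μ b c s t m ω‖ ≤ ∑ q ∈ Finset.range K, ‖charFun μ (|c| * (b ^ (q + 1))⁻¹ *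
      b ^ (-Int.fract (letterSum (contractionExponent b s) (m + 1) ω)))‖ := by
  have hb0 : 0 < b := one_pos.trans hb
  set θ := letterSum (contractionExponent b s) (m + 1) ω with hθ
  have hθ0 : 0 ≤ θ := letterSum_nonneg ha (m + 1) ω
  have hfl : (⌊θ⌋₊ : ℝ) + Int.fract θ = θ := by
    rw [natCast_floor_eq_intCast_floor hθ0, Int.floor_add_fract]
  refine (norm_sum_le_of_le (n := fun k => ‖charFun μ (|c| * (b ^ (⌊θ⌋₊ - 1 - k + 1))⁻¹ *
      b ^ (-Int.fract θ))‖) _ fun k hk => ?_).trans ?_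
  · rw [norm_mul, Complex.norm_exp_ofReal_mul_I, one_mul, ← norm_charFun_abs, abs_mul, abs_mul,
      abs_of_pos (by positivity : 0 < b ^ k), abs_ratioProd_eq_rpow hb hs0, ← hθ, mul_assoc,
      mul_assoc]
    have hk' : k < ⌊θ⌋₊ := (Finset.mem_Ico.1 hk).2
    have hsub : ⌊θ⌋₊ - 1 - k + 1 = ⌊θ⌋₊ - k := by omega
    have : b ^ k * b ^ (-θ) = (b ^ (⌊θ⌋₊ - k))⁻¹ * b ^ (-Int.fract θ) := by
      rw [← Real.rpow_natCast, ← Real.rpow_natCast, ← Real.rpow_neg hb0.le, ← Real.rpow_add hb0,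
        ← Real.rpow_add hb0, Nat.cast_sub hk'.le]
      congr 1
      linarith
    rw [hsub, this]
  · rw [← Finset.sum_image (s := timeBlock (contractionExponent b s) m ω)
      (g := fun k => ⌊θ⌋₊ - 1 - k) (f := fun q => ‖charFun μ (|c| * (b ^ (q + 1))⁻¹ *
      b ^ (-Int.fract θ))‖)]
    · refine Finset.sum_le_sum_of_subset_of_nonneg ?_ fun _ _ _ => norm_nonneg _
      intro q hq
      obtain ⟨k, hk, rfl⟩ := Finset.mem_image.1 hq
      have h1 := floor_letterSum_succ_le ha hK m ω
      have h2 := Finset.mem_Ico.1 hk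
      rw [← hθ] at h1 h2
      simp only [Finset.mem_range]
      omega
    · intro k hk k' hk' hkk
      have h1 := Finset.mem_Ico.1 hk
      have h2 := Finset.mem_Ico.1 hk'
      rw [← hθ] at h1 h2
      simp only at hkk
      omega

theorem sum_range_eq_sum_sum_Ico {κ : ℕ → ℕ} (hκ0 : κ 0 = 0) (hκ : Monotone κ) (e : ℕ → ℂ)
    (M : ℕ) : ∑ k ∈ Finset.range (κ M), e k =
      ∑ m ∈ Finset.range M, ∑ k ∈ Finset.Ico (κ m) (κ (m + 1)), e k := by
  induction M with
  | zero => simp [hκ0]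
  | succ M ih =>
    rw [Finset.sum_range_succ, ← ih, Finset.range_eq_Ico, Finset.range_eq_Ico,
      Finset.sum_Ico_consecutive _ (Nat.zero_le _) (hκ M.le_succ)]

theorem exists_le_le_add_of_step_le {κ : ℕ → ℕ} (hκ0 : κ 0 = 0) {K : ℕ}
    (hstep : ∀ m, κ (m + 1) ≤ κ m + K) (hunb : ∀ N, ∃ M, N < κ M) (N : ℕ) :
    ∃ M, κ M ≤ N ∧ N ≤ κ M + K := by
  classical
  have hpos : Nat.find (hunb N) ≠ 0 := fun h => by
    have := Nat.find_spec (hunb N)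
    rw [h, hκ0] at this
    omega
  obtain ⟨M, hM⟩ := Nat.exists_eq_succ_of_ne_zero hpos
  have h1 := Nat.find_spec (hunb N)
  have h2 := Nat.find_min (hunb N) (m := M) (by omega)
  rw [hM] at h1
  have h3 := hstep M
  exact ⟨M, by omega, by simp only [Nat.succ_eq_add_one] at h1; omega⟩

theorem norm_sum_range_sub_shift_le {e : ℕ → ℂ} (he : ∀ k, ‖e k‖ ≤ 1) (L N : ℕ) :
    ‖∑ k ∈ Finset.range N, e k‖ ≤ ‖∑ k ∈ Finset.range N, e (k + L)‖ + 2 * L := by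
  have h1 := Finset.sum_range_add e L N
  have h2 := Finset.sum_range_add e N L
  rw [add_comm L N, h2] at h1
  have hn : ∀ f : ℕ → ℂ, (∀ k, ‖f k‖ ≤ 1) → ‖∑ k ∈ Finset.range L, f k‖ ≤ L := fun f hf =>
    (norm_sum_le_of_le (n := fun _ => 1) _ fun k _ => hf k).trans (by simp)
  have h3 : ∑ k ∈ Finset.range N, e k = ∑ k ∈ Finset.range N, e (k + L) +
      (∑ k ∈ Finset.range L, e k - ∑ k ∈ Finset.range L, e (N + k)) := by
    simp only [add_comm _ L]
    linear_combination h1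
  rw [h3]
  refine (norm_add_le _ _).trans ?_
  gcongr
  refine (norm_sub_le _ _).trans ?_
  linarith [hn e he, hn (fun k => e (N + k)) fun k => he _]

/-- An exponential sum is negligible as soon as its shifts are negligible along a sequence of
times with bounded gaps and positive speed. -/
theorem tendsto_average_of_shifts_along {e : ℕ → ℂ} (he : ∀ k, ‖e k‖ ≤ 1) {κ : ℕ → ℕ}
    (hκ0 : κ 0 = 0) {K : ℕ} (hstep : ∀ m, κ (m + 1) ≤ κ m + K) {α : ℝ}
    (hα : 0 < α) (hκα : ∀ M : ℕ, α * M ≤ κ M + 1)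
    (h : ∀ ε > 0, ∃ L : ℕ, ∃ C : ℝ, ∀ M : ℕ,
      ‖∑ k ∈ Finset.range (κ M), e (k + L)‖ ≤ ε * M + C) :
    Tendsto (fun N : ℕ => (N : ℂ)⁻¹ * ∑ k ∈ Finset.range N, e k) atTop (𝓝 0) := by
  have hunb : ∀ N, ∃ M, N < κ M := fun N => by
    obtain ⟨M, hM⟩ := exists_nat_gt ((N + 1) / α)
    rw [div_lt_iff₀ hα] at hM
    have := hκα M
    exact ⟨M, by exact_mod_cast (by linarith : (N : ℝ) < κ M)⟩
  refine Metric.tendsto_nhds.2 fun ε hε => ?_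
  obtain ⟨L, C, hC⟩ := h (ε / 2 * α) (by positivity)
  have hlim : Tendsto (fun N : ℕ => (N : ℝ)⁻¹ * (ε / 2 + C + K + 2 * L)) atTop (𝓝 0) := by
    simpa using (tendsto_inv_atTop_nhds_zero_nat (𝕜 := ℝ)).mul_const (ε / 2 + C + K + 2 * L)
  filter_upwards [hlim.eventually_lt_const (half_pos hε), eventually_gt_atTop 0] with N hN hN0
  obtain ⟨M, hM1, hM2⟩ := exists_le_le_add_of_step_le hκ0 hstep hunb N
  have hN0' : (0 : ℝ) < N := by exact_mod_cast hN0
  have hM : α * M ≤ N + 1 := (hκα M).trans (by gcongr)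
  have hsplit : ‖∑ k ∈ Finset.range N, e (k + L)‖ ≤
      ‖∑ k ∈ Finset.range (κ M), e (k + L)‖ + K := by
    rw [← Finset.sum_range_add_sum_Ico _ hM1]
    refine (norm_add_le _ _).trans ?_
    gcongr
    refine (norm_sum_le_of_le (n := fun _ => 1) _ fun k _ => he _).trans ?_
    rw [Finset.sum_const, Nat.card_Ico, nsmul_eq_mul, mul_one]
    exact_mod_cast (by omega : N - κ M ≤ K)
  have hbound : ‖∑ k ∈ Finset.range N, e k‖ ≤ ε / 2 * N + (ε / 2 + C + K + 2 * L) := by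
    have := norm_sum_range_sub_shift_le he L N
    have := hC M
    nlinarith
  rw [dist_zero_right, norm_mul, norm_inv, Complex.norm_natCast]
  calc (N : ℝ)⁻¹ * ‖∑ k ∈ Finset.range N, e k‖
      ≤ (N : ℝ)⁻¹ * (ε / 2 * N + (ε / 2 + C + K + 2 * L)) := by gcongr
    _ = ε / 2 + (N : ℝ)⁻¹ * (ε / 2 + C + K + 2 * L) := by field_simp
    _ < ε := by linarith

theorem exists_le_mul_add_of_tendsto_average {u : ℕ → ℝ} {l ε : ℝ}
    (h : Tendsto (fun M : ℕ => (M : ℝ)⁻¹ * u M) atTop (𝓝 l)) (hl : l < ε) (hε : 0 < ε) :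
    ∃ C : ℝ, ∀ M : ℕ, u M ≤ ε * M + C := by
  obtain ⟨M₀, hM₀⟩ := eventually_atTop.1 ((h.eventually_lt_const hl).and (eventually_gt_atTop 0))
  refine ⟨∑ m ∈ Finset.range M₀, |u m|, fun M => ?_⟩
  have hnn : 0 ≤ ∑ m ∈ Finset.range M₀, |u m| := Finset.sum_nonneg fun _ _ => abs_nonneg _
  by_cases hM : M < M₀
  · have h1 : |u M| ≤ ∑ m ∈ Finset.range M₀, |u m| :=
      Finset.single_le_sum (f := fun m => |u m|) (fun _ _ => abs_nonneg _) (Finset.mem_range.2 hM)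
    have h2 : 0 ≤ ε * M := by positivity
    linarith [le_abs_self (u M)]
  · obtain ⟨h1, h2⟩ := hM₀ M (not_lt.1 hM)
    have h3 : (0 : ℝ) < M := by exact_mod_cast h2
    rw [inv_mul_lt_iff₀ h3] at h1
    linarith

theorem continuous_sum_norm_charFun_rpow (μ : Measure ℝ) [IsProbabilityMeasure μ] {b : ℝ}
    (hb : 1 < b) (K : ℕ) (c : ℝ) :
    Continuous fun v : ℝ => ∑ q ∈ Finset.range K,
      ‖charFun μ (|c| * (b ^ (q + 1))⁻¹ * b ^ (-v))‖ := by
  have hpow : Continuous fun v : ℝ => b ^ (-v) :=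
    continuous_const.rpow continuous_neg fun _ => Or.inl (one_pos.trans hb).ne'
  have hφ := continuous_charFun (μ := μ)
  exact continuous_finsetSum _ fun q _ => (hφ.comp (by fun_prop)).norm

theorem tendsto_integral_sum_norm_charFun_rpow {μ : Measure ℝ} [IsProbabilityMeasure μ]
    (hna : ∀ x : ℝ, μ {x} = 0) {b : ℝ} (hb : 1 < b) (K : ℕ) {c : ℝ} (hc : c ≠ 0) :
    Tendsto (fun L : ℕ => ∫ v in (0 : ℝ)..1, ∑ q ∈ Finset.range K,
      ‖charFun μ (|c * b ^ L| * (b ^ (q + 1))⁻¹ * b ^ (-v))‖) atTop (𝓝 0) := by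
  have hb0 : 0 < b := one_pos.trans hb
  have hpow : Continuous fun v : ℝ => b ^ (-v) :=
    continuous_const.rpow continuous_neg fun _ => Or.inl hb0.ne'
  have hφ := continuous_charFun (μ := μ)
  have h : Tendsto (fun L : ℕ => ∑ q ∈ Finset.range K, ∫ v in (0 : ℝ)..1,
      ‖charFun μ (|c * b ^ L| * (b ^ (q + 1))⁻¹ * b ^ (-v))‖) atTop
      (𝓝 (∑ q ∈ Finset.range K, 0)) := by
    refine tendsto_finsetSum _ fun q _ => (tendsto_integral_norm_charFun_rpow hna hb).comp ?_
    refine Tendsto.atTop_mul_const (by positivity) ?_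
    simp only [abs_mul, abs_pow, abs_of_pos hb0]
    exact (tendsto_pow_atTop_atTop_of_one_lt hb).const_mul_atTop (abs_pos.2 hc)
  rw [Finset.sum_const_zero] at h
  refine h.congr fun L => (intervalIntegral.integral_finsetSum fun q _ => ?_).symm
  exact ((hφ.comp (by fun_prop)).norm).intervalIntegrable _ _

theorem ae_tendsto_average_exp_coding {n : ℕ} {p : Fin n → ℝ} (hp : ∀ i, 0 < p i)
    (hpsum : ∑ i, p i = 1) [IsProbabilityMeasure (weightMeasure p)] {b : ℝ} (hb : 1 < b)
    {s t : Fin n → ℝ} (hs0 : ∀ i, s i ≠ 0) {α : ℝ} (hα : 0 < α)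
    (ha : ∀ i, α ≤ contractionExponent b s i) {K : ℕ}
    (hK : ∀ i, contractionExponent b s i ≤ K) {ρ T : ℝ} (hρ0 : 0 < ρ)
    (hρ1 : ρ < 1) (hs : ∀ i, |s i| ≤ ρ) (ht : ∀ i, |t i| ≤ T) (hT : 0 ≤ T) {μ : Measure ℝ}
    [IsProbabilityMeasure μ] (hna : ∀ x : ℝ, μ {x} = 0)
    (hmap : Measure.map (coding s t) (Measure.infinitePi fun _ : ℕ => weightMeasure p) = μ)
    {i : Fin n} (hirr : Irrational (contractionExponent b s i)) {c : ℝ} (hc : c ≠ 0) :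
    ∀ᵐ ω ∂(Measure.infinitePi fun _ : ℕ => weightMeasure p),
      Tendsto (fun N : ℕ => (N : ℂ)⁻¹ * ∑ k ∈ Finset.range N,
        Complex.exp ((c * b ^ k * coding s t ω : ℝ) * Complex.I)) atTop (𝓝 0) := by
  have ha0 : ∀ i, 0 ≤ contractionExponent b s i := fun i => hα.le.trans (ha i)
  have hW := ae_all_iff.2 fun L : ℕ => ae_tendsto_average_expBlock_sub hb hs0 ha0 hK hρ0 hρ1 hs ht
    hT μ hmap (c * b ^ L)
  filter_upwards [hW, ae_tendsto_average_fract_letterSum hp hpsum hirr] with ω hω hθ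
  set a := contractionExponent b s with ha'
  have hmono : Monotone fun m => ⌊letterSum a m ω⌋₊ := monotone_nat_of_le_succ fun m =>
    Nat.floor_mono (by rw [letterSum_succ]; linarith [ha0 (ω m)])
  have hzero : ⌊letterSum a 0 ω⌋₊ = 0 := by simp [letterSum]
  refine tendsto_average_of_shifts_along (κ := fun m => ⌊letterSum a m ω⌋₊) (K := K) (α := α)
    (fun k => (Complex.norm_exp_ofReal_mul_I _).le) hzero
    (fun m => floor_letterSum_succ_le ha0 hK m ω) hα (fun M => ?_) fun ε hε => ?_
  · have h1 : α * M ≤ letterSum a M ω := by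
      have := Finset.card_nsmul_le_sum (Finset.range M) (fun j => a (ω j)) α fun j _ => ha (ω j)
      rw [Finset.card_range, nsmul_eq_mul, mul_comm] at this
      exact this
    exact h1.trans (Nat.lt_floor_add_one _).le
  · obtain ⟨L, hL⟩ := ((tendsto_integral_sum_norm_charFun_rpow hna hb K hc).eventually_lt_const
      hε).exists
    have hG := hθ _ (continuous_sum_norm_charFun_rpow μ hb K (c * b ^ L))
    have hsum := (tendsto_zero_iff_norm_tendsto_zero.1 (hω L)).add hG
    rw [zero_add] at hsum
    simp only [norm_mul, norm_inv, Complex.norm_natCast, ← mul_add] at hsum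
    obtain ⟨C, hC⟩ := exists_le_mul_add_of_tendsto_average hsum hL hε
    refine ⟨L, C, fun M => le_trans ?_ (hC M)⟩
    have hY : ∑ k ∈ Finset.range ⌊letterSum a M ω⌋₊,
        Complex.exp ((c * b ^ (k + L) * coding s t ω : ℝ) * Complex.I) =
        ∑ m ∈ Finset.range M, expBlock b (c * b ^ L) s t m ω := by
      rw [sum_range_eq_sum_sum_Ico hzero hmono]
      refine Finset.sum_congr rfl fun m _ => Finset.sum_congr rfl fun k _ => ?_
      congr 3
      ring
    have hdecomp : ∑ m ∈ Finset.range M, expBlock b (c * b ^ L) s t m ω =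
        ∑ m ∈ Finset.range M, (expBlock b (c * b ^ L) s t m ω -
          expBlockMean μ b (c * b ^ L) s t m ω) +
        ∑ m ∈ Finset.range M, expBlockMean μ b (c * b ^ L) s t m ω := by
      rw [← Finset.sum_add_distrib]
      exact Finset.sum_congr rfl fun m _ => (sub_add_cancel _ _).symm
    rw [hY, hdecomp]
    refine (norm_add_le _ _).trans (add_le_add le_rfl (norm_sum_le_of_le _ fun m _ => ?_))
    exact norm_expBlockMean_le_sum_charFun μ hb hs0 ha0 hK (c * b ^ L) t m ω

/-- For a non-atomic self-similar measure `μ` on `ℝ` associated to the IFS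
`{fᵢ(x) = sᵢ·x + tᵢ}` and a strictly positive probability vector, if `log |sᵢ| / log b`
is irrational for some `i`, then `μ`-almost every `x` is normal in base `b`. -/
theorem stmt0
    (n : ℕ) (s t : Fin n → ℝ)
    (hs : ∀ i, |s i| < 1) (hs0 : ∀ i, s i ≠ 0)
    (p : Fin n → ℝ) (hp : ∀ i, 0 < p i) (hpsum : ∑ i, p i = 1)
    (μ : Measure ℝ) (hprob : IsProbabilityMeasure μ)
    (hself : μ = ∑ i, ENNReal.ofReal (p i) • Measure.map (fun x => s i * x + t i) μ)
    (hna : ∀ x : ℝ, μ {x} = 0)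
    (b : ℕ) (hb : 2 ≤ b)
    (i : Fin n) (hirr : Irrational (Real.log |s i| / Real.log b)) :
    ∀ᵐ x ∂μ, ∀ g : ℝ → ℝ, Continuous g →
      Tendsto (fun N : ℕ => (N : ℝ)⁻¹ * ∑ k ∈ Finset.range N, g (Int.fract ((b : ℝ) ^ k * x)))
        atTop (𝓝 (∫ y in (0:ℝ)..1, g y)) := by
  have hb1 : (1 : ℝ) < b := by exact_mod_cast hb
  have hlog : 0 < Real.log b := Real.log_pos hb1
  have hne : Nonempty (Fin n) := ⟨i⟩
  have hpm : IsProbabilityMeasure (weightMeasure p) := isProbabilityMeasure_weightMeasure hp hpsum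
  obtain ⟨i₀, hi₀⟩ := Finite.exists_max fun i => |s i|
  obtain ⟨i₁, hi₁⟩ := Finite.exists_min (contractionExponent b s)
  obtain ⟨i₂, hi₂⟩ := Finite.exists_max (contractionExponent (b : ℝ) s)
  obtain ⟨K, hK⟩ := exists_nat_ge (contractionExponent b s i₂)
  obtain ⟨i₃, hi₃⟩ := Finite.exists_max fun i => |t i|
  have hα : 0 < contractionExponent b s i₁ :=
    neg_pos.2 (div_neg_of_neg_of_pos (Real.log_neg (abs_pos.2 (hs0 _)) (hs _)) hlog)
  have hmap := map_coding_eq hp hpsum (abs_pos.2 (hs0 i₀)) (hs i₀) hi₀ hi₃ μ hself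
  have hweyl : ∀ᵐ x ∂μ, ∀ j : ℤ, j ≠ 0 → Tendsto (fun N : ℕ => (N : ℂ)⁻¹ *
      ∑ k ∈ Finset.range N, Complex.exp ((2 * Real.pi * j * (b : ℝ) ^ k * x : ℝ) * Complex.I))
      atTop (𝓝 0) := by
    refine ae_all_iff.2 fun j => ?_
    by_cases hj : j = 0
    · exact Eventually.of_forall fun x h => absurd hj h
    have hmeas : MeasurableSet {x : ℝ | Tendsto (fun N : ℕ => (N : ℂ)⁻¹ *
        ∑ k ∈ Finset.range N, Complex.exp ((2 * Real.pi * j * (b : ℝ) ^ k * x : ℝ) * Complex.I))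
        atTop (𝓝 0)} := measurableSet_tendsto _ fun N => by fun_prop
    have hj' : (2 * Real.pi * j : ℝ) ≠ 0 :=
      mul_ne_zero (by positivity) (by exact_mod_cast hj)
    have h := ae_tendsto_average_exp_coding hp hpsum hb1 hs0 hα hi₁
      (fun i => (hi₂ i).trans hK) (abs_pos.2 (hs0 i₀)) (hs i₀) hi₀ hi₃ (abs_nonneg _) hna hmap
      (i := i) hirr.neg hj'
    have h' := (ae_map_iff (measurable_coding s t).aemeasurable hmeas).2 h
    rw [hmap] at h'
    filter_upwards [h'] with x hx _ using hx
  filter_upwards [hweyl] with x hx g hg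
  refine weyl_fract _ (fun j hj => (hx j hj).congr fun N => ?_) g hg
  congr 1
  refine Finset.sum_congr rfl fun k _ => ?_
  congr 1
  push_cast
  ring
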